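/- arXiv:2301.13040 — 3 statements merged into one kernel-verified Lean document; each statement's English description precedes it below -/
import Mathlib

section
/- Let k be a field, n ≥ 1, and let f ∈ k[x_0, …, x_n] be an irreducible homogeneous polynomial of degree d ≥ 1. Let U ⊆ P^n_k be an open subvariety. If there exists an isomorphism P^n_f ≅ U, then there exists an irreducible homogeneous polynomial g ∈ k[x_0, …, x_n] of degree d such that U = P^n_g. -/
/-!
Common set-up: projective `n`-space over a field `k` as the scheme
`Proj k[x_0, …, x_n]`, complements of hypersurfaces as open subschemes,
hypersurfaces as reduced closed subschemes, and isomorphisms of varieties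
over `k` as scheme isomorphisms commuting with the structure morphisms
to `Spec k`.
-/

open AlgebraicGeometry CategoryTheory MvPolynomial

attribute [local instance] MvPolynomial.gradedAlgebra

noncomputable section

/-- The standard grading on the polynomial ring `k[x_0, …, x_n]`. -/
abbrev grading (k : Type) [Field k] (n : ℕ) := homogeneousSubmodule (Fin (n + 1)) k

/-- Projective `n`-space over `k`, as a scheme. -/
abbrev ProjSpace (k : Type) [Field k] (n : ℕ) : Scheme := Proj (grading k n)

/-- The base scheme `Spec k`. -/
abbrev SpecK (k : Type) [Field k] : Scheme := Spec (CommRingCat.of k)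

/-- The structure morphism `ℙⁿ_k ⟶ Spec k`. -/
abbrev projStruct (k : Type) [Field k] (n : ℕ) : ProjSpace k n ⟶ SpecK k :=
  Proj.toSpecZero (grading k n) ≫
    Spec.map (CommRingCat.ofHom (algebraMap k ((grading k n) 0)))

/-- The open complement `ℙⁿ_f = ℙⁿ ∖ V(f)` of the hypersurface `V(f)`, as a scheme. -/
abbrev PnF (k : Type) [Field k] (n : ℕ) (f : MvPolynomial (Fin (n + 1)) k) : Scheme :=
  (Proj.basicOpen (grading k n) f).toScheme

/-- The structure morphism `ℙⁿ_f ⟶ Spec k`. -/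
abbrev PnFStruct (k : Type) [Field k] (n : ℕ) (f : MvPolynomial (Fin (n + 1)) k) :
    PnF k n f ⟶ SpecK k :=
  (Proj.basicOpen (grading k n) f).ι ≫ projStruct k n

/-- Two schemes equipped with structure morphisms to a common base are isomorphic over
that base.  For varieties over `k` (with base `Spec k`) this is the usual notion of
isomorphism of varieties over `k`. -/
def IsoOver {X Y B : Scheme} (sX : X ⟶ B) (sY : Y ⟶ B) : Prop :=
  ∃ e : X ≅ Y, e.hom ≫ sY = sX

/-- The set of points of `ℙⁿ` where `f` vanishes. -/
def zeroLocusSet (k : Type) [Field k] (n : ℕ) (f : MvPolynomial (Fin (n + 1)) k) :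
    Set (ProjSpace k n) :=
  {x | f ∈ (x : ProjectiveSpectrum (grading k n)).asHomogeneousIdeal}

/-- `ι : H ⟶ ℙⁿ` realizes the scheme `H` as the hypersurface `V(f) ⊆ ℙⁿ`, i.e. as the
reduced closed subscheme of `ℙⁿ` whose underlying set is the zero locus of `f`. -/
structure IsHypersurface {k : Type} [Field k] {n : ℕ} (f : MvPolynomial (Fin (n + 1)) k)
    (H : Scheme) (ι : H ⟶ ProjSpace k n) : Prop where
  isClosedImmersion : IsClosedImmersion ι
  reduced : IsReduced H
  range_eq : Set.range ι.base = zeroLocusSet k n f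

section Homogeneous

variable {σ k : Type*} [Field k]

/-- The `k`-algebra map `p ↦ ∑ pᵢ Tⁱ`, where `pᵢ` is the homogeneous component of degree `i`. -/
def homogenizeHom : MvPolynomial σ k →ₐ[k] Polynomial (MvPolynomial σ k) :=
  aeval fun i => Polynomial.C (X i) * Polynomial.X

lemma homogenizeHom_of_isHomogeneous {p : MvPolynomial σ k} {m : ℕ} (hp : p.IsHomogeneous m) :
    homogenizeHom p = Polynomial.C p * Polynomial.X ^ m := by
  conv_lhs => rw [p.as_sum, map_sum]
  conv_rhs => rw [p.as_sum, map_sum, Finset.sum_mul]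
  refine Finset.sum_congr rfl fun s hs => ?_
  have hm : s.sum (fun _ e => e) = m := (hp.degree_eq_sum_deg_support hs).symm
  rw [homogenizeHom, aeval_monomial, monomial_eq, map_mul, ← hm]
  simp only [Finsupp.prod, Finsupp.sum, mul_pow, Finset.prod_mul_distrib, Finset.prod_pow_eq_pow_sum,
    map_prod, map_pow]
  rw [mul_assoc]
  rfl

lemma coeff_homogenizeHom (p : MvPolynomial σ k) (m : ℕ) :
    (homogenizeHom p).coeff m = homogeneousComponent m p := by
  conv_lhs => rw [← sum_homogeneousComponent p, map_sum]
  simp only [homogenizeHom_of_isHomogeneous (homogeneousComponent_isHomogeneous _ p),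
    Polynomial.finsetSum_coeff, Polynomial.coeff_C_mul, Polynomial.coeff_X_pow]
  simp only [mul_ite, mul_one, mul_zero, Finset.sum_ite_eq, Finset.mem_range]
  split_ifs with h
  · rfl
  · rw [homogeneousComponent_eq_zero]; lia

lemma MvPolynomial.IsHomogeneous.of_mul_left {p q : MvPolynomial σ k} {m : ℕ}
    (h : (p * q).IsHomogeneous m) (h0 : p * q ≠ 0) : ∃ i, p.IsHomogeneous i := by
  have hinj : ∀ r : MvPolynomial σ k, r ≠ 0 → homogenizeHom r ≠ 0 := by
    intro r hr h
    apply hr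
    rw [← sum_homogeneousComponent r]
    exact Finset.sum_eq_zero fun i _ => by rw [← coeff_homogenizeHom, h, Polynomial.coeff_zero]
  have hp := hinj p (left_ne_zero_of_mul h0)
  have hq := hinj q (right_ne_zero_of_mul h0)
  have e := homogenizeHom_of_isHomogeneous h
  rw [map_mul] at e
  have e1 := congrArg Polynomial.natDegree e
  have e2 := congrArg Polynomial.natTrailingDegree e
  rw [Polynomial.natDegree_mul hp hq, Polynomial.natDegree_C_mul_X_pow _ _ h0] at e1
  rw [Polynomial.natTrailingDegree_mul hp hq, Polynomial.C_mul_X_pow_eq_monomial,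
    Polynomial.natTrailingDegree_monomial h0] at e2
  have l1 := Polynomial.natTrailingDegree_le_natDegree (homogenizeHom p)
  have l2 := Polynomial.natTrailingDegree_le_natDegree (homogenizeHom q)
  have l3 : (homogenizeHom p).natTrailingDegree = (homogenizeHom p).natDegree := by lia
  refine ⟨(homogenizeHom p).natDegree, ?_⟩
  intro s hs
  have hs' : (homogenizeHom p).coeff s.degree ≠ 0 := by
    intro hc
    rw [coeff_homogenizeHom] at hc
    apply hs
    simpa [coeff_homogeneousComponent] using congrArg (coeff s) hc
  have h1 := Polynomial.le_natDegree_of_ne_zero hs'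
  have h2 := Polynomial.natTrailingDegree_le_of_ne_zero hs'
  have h3 : Finsupp.weight 1 s = s.degree := by
    rw [Finsupp.degree_eq_weight_one]
    rfl
  lia

lemma MvPolynomial.IsHomogeneous.of_dvd {p q : MvPolynomial σ k} {m : ℕ}
    (hq : q.IsHomogeneous m) (h0 : q ≠ 0) (h : p ∣ q) : ∃ i, p.IsHomogeneous i := by
  obtain ⟨r, rfl⟩ := h
  exact hq.of_mul_left h0

end Homogeneous

section ProjectiveSpace

variable {k : Type} [Field k] {n : ℕ}

local notation "R" => MvPolynomial (Fin (n + 1)) k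
local notation "K" => FractionRing (MvPolynomial (Fin (n + 1)) k)

/-- The degree-zero fractions `a / g ^ j`, for `g` homogeneous of degree `e`. -/
def degreeZeroAway (g : R) (e : ℕ) : Set K :=
  {y | ∃ j a, a.IsHomogeneous (e * j) ∧ y * algebraMap R K g ^ j = algebraMap R K a}

lemma exists_eq_of_mem_degreeZeroAway {g : R} {e : ℕ} (hg : g.IsHomogeneous e) {y : K}
    (hy : y ∈ degreeZeroAway g e) : ∃ j, ∀ i, j ≤ i → ∃ a : R, a.IsHomogeneous (e * i) ∧
      y * algebraMap R K g ^ i = algebraMap R K a := by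
  obtain ⟨j, a, ha, h⟩ := hy
  refine ⟨j, fun i hi => ?_⟩
  obtain ⟨l, rfl⟩ := Nat.exists_eq_add_of_le hi
  refine ⟨a * g ^ l, ?_, ?_⟩
  · convert ha.mul (hg.pow l) using 1
    ring
  · rw [map_mul, map_pow, ← h]
    ring

/-- In a factorial domain, if `Aᵈ C = Bᵈ⁺¹`, then `A = G uᵈ⁺¹` and `B = G uᵈ v`. -/
lemma exists_eq_mul_pow_of_pow_mul_eq_pow {S : Type*} [CommRing S] [IsDomain S]
    [UniqueFactorizationMonoid S] {A B C : S} {d : ℕ} (hA : A ≠ 0)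
    (h : A ^ d * C = B ^ (d + 1)) :
    ∃ G u v : S, A = G * u ^ (d + 1) ∧ B = G * u ^ d * v := by
  obtain ⟨u, v, c, huv, rfl, rfl⟩ := UniqueFactorizationMonoid.exists_reduced_factors A hA B
  have hc : c ≠ 0 := left_ne_zero_of_mul hA
  have h' : u ^ d * C = c * v ^ (d + 1) := by
    apply mul_left_cancel₀ (pow_ne_zero d hc)
    linear_combination h
  obtain ⟨G, rfl⟩ : u ^ d ∣ c := (huv.pow (m := d) (n := d + 1)).dvd_of_dvd_mul_right ⟨C, h'.symm⟩
  exact ⟨G, u, v, by ring, by ring⟩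

lemma eq_C_mul_pow_of_dvd_pow {f p : R} (hf : Prime f) {N : ℕ} (h : p ∣ f ^ N) :
    ∃ (c : k) (m : ℕ), c ≠ 0 ∧ p = C c * f ^ m := by
  obtain ⟨m, -, hm⟩ := (dvd_prime_pow hf N).1 h
  obtain ⟨u, hu⟩ := hm.symm
  obtain ⟨c, hc, hcu⟩ := MvPolynomial.isUnit_iff_eq_C_of_isReduced.1 u.isUnit
  exact ⟨c, m, hc.ne_zero, by rw [← hu, hcu, mul_comm]⟩

lemma div_pow_mem_degreeZeroAway {g : R} {e δ : ℕ} (hg : g ≠ 0) {u : R}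
    (hu : u.IsHomogeneous δ) :
    algebraMap R K u ^ e / algebraMap R K g ^ δ ∈ degreeZeroAway g e := by
  have hg' : algebraMap R K g ≠ 0 := by simpa using hg
  refine ⟨δ, u ^ e, by simpa [mul_comm] using hu.pow e, ?_⟩
  rw [map_pow]
  field_simp

lemma dvd_of_eq_mul_pow (hn : 1 ≤ n) {f : R} {d e : ℕ} (hf : Prime f)
    (hfd : f.IsHomogeneous (d + 1)) {c w z : K} (hc0 : c ∈ degreeZeroAway f (d + 1))
    (hw0 : w ∈ degreeZeroAway f (d + 1)) (hz0 : z ∈ degreeZeroAway f (d + 1))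
    (E1 : (algebraMap R K (X 0) ^ (d + 1) / algebraMap R K f) ^ e = c * w ^ (d + 1))
    (E2 : z * (algebraMap R K (X 0) ^ (d + 1) / algebraMap R K f) ^ e =
      w * (algebraMap R K (X 0) ^ d * algebraMap R K (X 1) / algebraMap R K f) ^ e) :
    d + 1 ∣ e := by
  have hf' : algebraMap R K f ≠ 0 := by simpa using hf.ne_zero
  have hx0 : algebraMap R K (X 0) ≠ 0 := by simp
  obtain ⟨jw, hw⟩ := exists_eq_of_mem_degreeZeroAway hfd hw0
  obtain ⟨jz, hz⟩ := exists_eq_of_mem_degreeZeroAway hfd hz0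
  obtain ⟨j, hjw, hjz⟩ : ∃ j, jw ≤ j ∧ jz ≤ j := ⟨max jw jz, by simp, by simp⟩
  obtain ⟨p, hp, hp'⟩ := hw j hjw
  obtain ⟨q, hq, hq'⟩ := hz j hjz
  obtain ⟨i, h, hh, hh'⟩ := hc0
  have F2 : q * X 0 ^ e = p * X 1 ^ e := by
    apply IsFractionRing.injective R K
    rw [div_pow, div_pow, mul_div_assoc', mul_div_assoc', div_left_inj' (pow_ne_zero e hf')] at E2
    apply mul_left_cancel₀ (pow_ne_zero (d * e) hx0)
    simp only [map_mul, map_pow, ← hp', ← hq']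
    linear_combination algebraMap R K f ^ j * E2
  have h01 : (0 : Fin (n + 1)) ≠ 1 := by
    have : NeZero n := ⟨by lia⟩
    exact Fin.zero_ne_one'
  have hX : IsRelPrime ((X 0 : R) ^ e) (X 1 ^ e) :=
    ((X_prime.irreducible.isRelPrime_iff_not_dvd).2 fun h => h01 (X_dvd_X.1 h)).pow
  obtain ⟨p', rfl⟩ : X 0 ^ e ∣ p := hX.dvd_of_dvd_mul_right ⟨q, by rw [← F2, mul_comm]⟩
  have F1 : f ^ (i + j * (d + 1)) = h * p' ^ (d + 1) * f ^ e := by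
    apply IsFractionRing.injective R K
    rw [div_pow, div_eq_iff (pow_ne_zero e hf')] at E1
    apply mul_left_cancel₀ (pow_ne_zero ((d + 1) * e) hx0)
    calc algebraMap R K (X 0) ^ ((d + 1) * e) * algebraMap R K (f ^ (i + j * (d + 1)))
        = (c * algebraMap R K f ^ i) * (w * algebraMap R K f ^ j) ^ (d + 1) *
            algebraMap R K f ^ e := by
          rw [pow_mul, E1, map_pow]
          ring
      _ = _ := by
          rw [hh', hp']
          simp only [map_mul, map_pow]
          ring
  obtain ⟨c', m, hc', rfl⟩ := eq_C_mul_pow_of_dvd_pow hf (p := p') (N := i + j * (d + 1))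
    ((dvd_pow_self p' d.succ_ne_zero).trans ⟨h * f ^ e, by rw [F1, Nat.succ_eq_add_one]; ring⟩)
  have hdeg := hp.inj_right ((isHomogeneous_X_pow 0 e).mul
    ((isHomogeneous_C _ c').mul (hfd.pow m))) (by simp [hc', hf.ne_zero])
  rw [zero_add] at hdeg
  exact (Nat.dvd_add_left (Dvd.intro _ rfl)).1 (hdeg ▸ Dvd.intro _ rfl)

theorem dvd_of_ringEquiv_degreeZeroAway (hn : 1 ≤ n) {f g : R} {d e : ℕ} (hd : 1 ≤ d)
    (hf : Prime f) (hfd : f.IsHomogeneous d) (hg : g ≠ 0) (hge : g.IsHomogeneous e)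
    {S T : Subring K} (hS : ∀ y, y ∈ S ↔ y ∈ degreeZeroAway f d)
    (hT : ∀ y, y ∈ T ↔ y ∈ degreeZeroAway g e) (φ : S ≃+* T) : d ∣ e := by
  obtain ⟨d, rfl⟩ := Nat.exists_eq_add_of_le' hd
  have hf' : algebraMap R K f ≠ 0 := by simpa using hf.ne_zero
  have hg' : algebraMap R K g ≠ 0 := by simpa using hg
  let x0 : K := algebraMap R K (X 0)
  let x1 : K := algebraMap R K (X 1)
  have hx0 : x0 ≠ 0 := by simp [x0]
  have hx1 : x1 ≠ 0 := by simp [x1]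
  have key : ∀ p : R, p.IsHomogeneous (d + 1) →
      algebraMap R K p / algebraMap R K f ∈ S := fun p hp =>
    (hS _).2 ⟨1, p, by simpa using hp, by field_simp⟩
  let a0 : S := ⟨algebraMap R K (X 0 ^ (d + 1)) / algebraMap R K f,
    key _ (isHomogeneous_X_pow _ _)⟩
  let a1 : S := ⟨algebraMap R K (X 0 ^ d * X 1) / algebraMap R K f,
    key _ ((isHomogeneous_X_pow _ _).mul (isHomogeneous_X _ _))⟩
  let ad : S := ⟨algebraMap R K (X 1 ^ (d + 1)) / algebraMap R K f,
    key _ (isHomogeneous_X_pow _ _)⟩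
  have ha : a0 ^ d * ad = a1 ^ (d + 1) := by
    apply Subtype.ext
    simp only [a0, a1, ad, Subring.coe_mul, Subring.coe_pow, map_mul, map_pow, div_pow]
    rw [div_mul_div_comm, ← pow_succ]
    congr 1
    ring
  have ha0 : a0 ≠ 0 := by
    intro h
    have := congrArg Subtype.val h
    simp [a0, hf.ne_zero] at this
  -- common denominators for the images
  obtain ⟨j0, h0⟩ := exists_eq_of_mem_degreeZeroAway hge ((hT _).1 (φ a0).2)
  obtain ⟨j1, h1⟩ := exists_eq_of_mem_degreeZeroAway hge ((hT _).1 (φ a1).2)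
  obtain ⟨j2, h2⟩ := exists_eq_of_mem_degreeZeroAway hge ((hT _).1 (φ ad).2)
  obtain ⟨r, hr0, hr1, hr2⟩ : ∃ r, j0 ≤ r ∧ j1 ≤ r ∧ j2 ≤ r :=
    ⟨max j0 (max j1 j2), by simp, by simp, by simp⟩
  obtain ⟨A, hA, hA'⟩ := h0 r hr0
  obtain ⟨B, hB, hB'⟩ := h1 r hr1
  obtain ⟨D, hD, hD'⟩ := h2 r hr2
  have hφ : ((φ a0 : T) : K) ^ d * (φ ad : T) = ((φ a1 : T) : K) ^ (d + 1) := by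
    have := congrArg (fun t => ((φ t : T) : K)) ha
    simpa using this
  have hA0 : A ≠ 0 := by
    rintro rfl
    rw [map_zero, mul_eq_zero] at hA'
    rcases hA' with h | h
    · exact ha0 (φ.injective (by rw [map_zero]; exact Subtype.ext h))
    · exact pow_ne_zero _ hg' h
  have hABD : A ^ d * D = B ^ (d + 1) := by
    apply IsFractionRing.injective R K
    rw [map_mul, map_pow, map_pow, ← hA', ← hB', ← hD', mul_pow, mul_pow, ← hφ]
    ring
  obtain ⟨G, u, v, rfl, rfl⟩ := exists_eq_mul_pow_of_pow_mul_eq_pow hA0 hABD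
  have hu0 : u ≠ 0 := by rintro rfl; simp at hA0
  have hG0 : G ≠ 0 := by rintro rfl; simp at hA0
  have hB0 : G * u ^ d * v ≠ 0 := by
    intro h
    rw [h, zero_pow (by simp)] at hABD
    have hD0 : D = 0 := (mul_eq_zero.1 hABD).resolve_left (pow_ne_zero _ hA0)
    rw [hD0, map_zero, mul_eq_zero] at hD'
    rcases hD' with h | h
    · have : ad = 0 := φ.injective (by rw [map_zero]; exact Subtype.ext h)
      have := congrArg Subtype.val this
      simp [ad, hf.ne_zero] at this
    · exact pow_ne_zero _ hg' h
  have hv0 : v ≠ 0 := right_ne_zero_of_mul hB0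
  obtain ⟨γ, hγ⟩ := hA.of_dvd hA0 (Dvd.intro _ rfl)
  obtain ⟨δ, hδ⟩ := hA.of_dvd hA0 ((dvd_pow_self u d.succ_ne_zero).trans (Dvd.intro_left _ rfl))
  obtain ⟨δ', hδ'⟩ := hB.of_dvd hB0 (Dvd.intro_left (G * u ^ d) rfl)
  have e1 : γ + δ * (d + 1) = e * r := (hγ.mul (hδ.pow _)).inj_right hA hA0
  have e2 : γ + δ * d + δ' = e * r := ((hγ.mul (hδ.pow _)).mul hδ').inj_right hB hB0
  obtain rfl : δ = δ' := by lia
  let w := φ.symm ⟨_, (hT _).2 (div_pow_mem_degreeZeroAway (e := e) hg hδ)⟩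
  let z := φ.symm ⟨_, (hT _).2 (div_pow_mem_degreeZeroAway (e := e) hg hδ')⟩
  let c := φ.symm ⟨_, (hT _).2 (div_pow_mem_degreeZeroAway (e := e) hg hγ)⟩
  have hA'' : ((φ a0 : T) : K) = algebraMap R K (G * u ^ (d + 1)) / algebraMap R K g ^ r := by
    rw [← hA']; field_simp
  have hB'' : ((φ a1 : T) : K) = algebraMap R K (G * u ^ d * v) / algebraMap R K g ^ r := by
    rw [← hB']; field_simp
  have E1 : a0 ^ e = c * w ^ (d + 1) := by
    apply φ.injective
    apply Subtype.ext
    simp only [map_mul, map_pow, w, c, RingEquiv.apply_symm_apply, Subring.coe_mul,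
      Subring.coe_pow, hA'']
    rw [div_pow, ← pow_mul _ r e, mul_comm r e, ← e1, div_pow, div_mul_div_comm, ← pow_mul _ δ,
      ← pow_add]
    congr 1
    ring
  have E2 : z * a0 ^ e = w * a1 ^ e := by
    apply φ.injective
    apply Subtype.ext
    simp only [map_mul, map_pow, w, z, RingEquiv.apply_symm_apply, Subring.coe_mul,
      Subring.coe_pow, hA'', hB'']
    field_simp
    ring
  refine dvd_of_eq_mul_pow hn hf hfd ((hS _).1 c.2) ((hS _).1 w.2) ((hS _).1 z.2) ?_ ?_
  · simpa [a0] using congrArg Subtype.val E1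
  · simpa [a0, a1] using congrArg Subtype.val E2

lemma not_X_zero_dvd_X_one (hn : 1 ≤ n) : ¬ (X 0 : R) ∣ X 1 := by
  have : NeZero n := ⟨by lia⟩
  exact fun h => Fin.zero_ne_one' (X_dvd_X.1 h)

/-- The point of `ℙⁿ` given by a homogeneous polynomial generating a prime ideal. -/
def pointOfPrime (hn : 1 ≤ n) (p : R) {i : ℕ} (hpi : p.IsHomogeneous i) (hp : p = 0 ∨ Prime p) :
    ProjectiveSpectrum (grading k n) where
  asHomogeneousIdeal := ⟨Ideal.span {p}, Ideal.homogeneous_span _ _ (by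
    rintro x rfl
    exact ⟨i, hpi⟩)⟩
  isPrime := by
    change (Ideal.span {p}).IsPrime
    rcases eq_or_ne p 0 with rfl | h
    · simpa using Ideal.isPrime_bot
    · exact (Ideal.span_singleton_prime h).2 (hp.resolve_left h)
  not_irrelevant_le := by
    intro h
    have hX : ∀ j, p ∣ X j := fun j => Ideal.mem_span_singleton.1 (h (by
      rw [HomogeneousIdeal.mem_irrelevant_iff, GradedRing.proj_apply]
      exact DirectSum.decompose_of_mem_ne _ (isHomogeneous_X k j) one_ne_zero))
    rcases hp with rfl | hp
    · exact X_ne_zero 0 (zero_dvd_iff.1 (hX 0))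
    · exact not_X_zero_dvd_X_one hn
        ((hp.irreducible.associated_of_dvd X_prime.irreducible (hX 0)).symm.dvd.trans (hX 1))

lemma mem_pointOfPrime (hn : 1 ≤ n) {p : R} {i : ℕ} (hpi : p.IsHomogeneous i)
    (hp : p = 0 ∨ Prime p) (q : R) :
    q ∈ (pointOfPrime hn p hpi hp).asHomogeneousIdeal ↔ p ∣ q :=
  Ideal.mem_span_singleton

/-- The generic point of `ℙⁿ`. -/
def genericPt (k : Type) [Field k] {n : ℕ} (hn : 1 ≤ n) : ProjSpace k n :=
  pointOfPrime hn 0 (isHomogeneous_zero _ _ 0) (Or.inl rfl)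

lemma genericPt_mem_basicOpen (hn : 1 ≤ n) {q : R} (hq : q ≠ 0) :
    genericPt k hn ∈ Proj.basicOpen (grading k n) q :=
  fun h => hq (zero_dvd_iff.1 ((mem_pointOfPrime hn _ _ q).1 h))

lemma ne_zero_of_mem_basicOpen {x : ProjSpace k n} {q : R}
    (hx : x ∈ Proj.basicOpen (grading k n) q) : q ≠ 0 := by
  rintro rfl
  exact hx (zero_mem _)

lemma genericPt_mem (hn : 1 ≤ n) {U : (ProjSpace k n).Opens} {x : ProjSpace k n} (hx : x ∈ U) :
    genericPt k hn ∈ U := by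
  obtain ⟨_, ⟨_, ⟨q, rfl⟩, rfl⟩, hxq, hqU⟩ :=
    (Proj.isBasis_basicOpen (grading k n)).exists_subset_of_mem_open hx U.2
  exact hqU (genericPt_mem_basicOpen hn (ne_zero_of_mem_basicOpen hxq))

/-- The inclusion of the local ring of `ℙⁿ` at a point into the field of rational functions. -/
def localToFractionRing (x : ProjectiveSpectrum (grading k n)) :
    HomogeneousLocalization.AtPrime (grading k n) x.asHomogeneousIdeal.toIdeal →+* K :=
  (IsLocalization.lift (M := x.asHomogeneousIdeal.toIdeal.primeCompl)
    (S := Localization x.asHomogeneousIdeal.toIdeal.primeCompl) (g := algebraMap R K) (fun y =>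
    IsUnit.mk0 _ (by
      have : (y : R) ≠ 0 := fun h => y.2 (h ▸ zero_mem _)
      simpa using this))).comp (algebraMap _ _)

lemma localToFractionRing_mk (x : ProjectiveSpectrum (grading k n)) (y) :
    localToFractionRing x (HomogeneousLocalization.mk y) =
      algebraMap R K y.num / algebraMap R K y.den := by
  have h0 : (y.den : R) ≠ 0 := fun h => y.den_mem (h ▸ zero_mem _)
  rw [localToFractionRing, RingHom.comp_apply, HomogeneousLocalization.algebraMap_apply,
    HomogeneousLocalization.val_mk, Localization.mk_eq_mk', IsLocalization.lift_mk'_spec,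
    mul_div_cancel₀ _ (by simpa using h0)]

lemma localToFractionRing_injective (x : ProjectiveSpectrum (grading k n)) :
    Function.Injective (localToFractionRing x) := by
  rw [injective_iff_map_eq_zero]
  intro s hs
  obtain ⟨y, rfl⟩ := HomogeneousLocalization.mk_surjective s
  have h0 : (y.den : R) ≠ 0 := fun h => y.den_mem (h ▸ zero_mem _)
  rw [localToFractionRing_mk, div_eq_zero_iff,
    or_iff_left (by simpa using h0), map_eq_zero_iff _ (IsFractionRing.injective R K)] at hs
  apply HomogeneousLocalization.val_injective
  rw [HomogeneousLocalization.val_mk, hs, Localization.mk_zero, HomogeneousLocalization.val_zero]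

/-- The rational function associated with a section of the structure sheaf of `ℙⁿ`. -/
def genericValue (hn : 1 ≤ n) (U : (ProjSpace k n).Opens) (hU : genericPt k hn ∈ U) :
    Γ(ProjSpace k n, U) →+* K :=
  (localToFractionRing (genericPt k hn)).comp
    (openToLocalization (grading k n) U (genericPt k hn) hU).hom

lemma genericValue_eq (hn : 1 ≤ n) (U : (ProjSpace k n).Opens) (hU : genericPt k hn ∈ U)
    (s : Γ(ProjSpace k n, U)) (x : U) :
    genericValue hn U hU s =
      localToFractionRing x.1 (openToLocalization (grading k n) U x.1 x.2 s) := by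
  obtain ⟨V, hxV, i, m, a, b, h, e⟩ := s.2 x
  exact (congrArg (localToFractionRing (genericPt k hn))
      (e ⟨genericPt k hn, genericPt_mem hn hxV⟩)).trans
    ((localToFractionRing_mk _ _).trans
      ((localToFractionRing_mk x.1 ⟨m, a, b, h ⟨x.1, hxV⟩⟩).symm.trans
      (congrArg (localToFractionRing x.1) (e ⟨x.1, hxV⟩)).symm))

lemma genericValue_injective (hn : 1 ≤ n) (U : (ProjSpace k n).Opens) (hU : genericPt k hn ∈ U) :
    Function.Injective (genericValue hn U hU) := by
  intro s t h
  refine Subtype.ext (funext fun x => localToFractionRing_injective x.1 ?_)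
  exact ((genericValue_eq hn U hU s x).symm.trans h).trans (genericValue_eq hn U hU t x)

lemma exists_eq_of_genericValue (hn : 1 ≤ n) (U : (ProjSpace k n).Opens)
    (hU : genericPt k hn ∈ U) (s : Γ(ProjSpace k n, U)) (x : U) :
    ∃ (i : ℕ) (a b : R), a.IsHomogeneous i ∧ b.IsHomogeneous i ∧
      x.1 ∈ Proj.basicOpen (grading k n) b ∧
      genericValue hn U hU s * algebraMap R K b = algebraMap R K a := by
  obtain ⟨V, hxV, i, m, a, b, h, e⟩ := s.2 x
  refine ⟨m, a, b, a.2, b.2, h ⟨x.1, hxV⟩, ?_⟩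
  have h0 : (b : R) ≠ 0 := ne_zero_of_mem_basicOpen (x := x.1) (h ⟨x.1, hxV⟩)
  rw [genericValue_eq hn U hU s x, ← eq_div_iff (by simpa using h0)]
  exact (congrArg (localToFractionRing x.1) (e ⟨x.1, hxV⟩)).trans
    (localToFractionRing_mk x.1 ⟨m, a, b, h ⟨x.1, hxV⟩⟩)

lemma exists_genericValue_eq (hn : 1 ≤ n) (U : (ProjSpace k n).Opens)
    (hU : genericPt k hn ∈ U) (y : K) (hy : ∀ x : U, ∃ (i : ℕ) (a b : R), a.IsHomogeneous i ∧
      b.IsHomogeneous i ∧ x.1 ∈ Proj.basicOpen (grading k n) b ∧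
      y * algebraMap R K b = algebraMap R K a) :
    ∃ s, genericValue hn U hU s = y := by
  choose i a b ha hb hx h using hy
  have key (x z : U) (hz : z.1 ∈ Proj.basicOpen (grading k n) (b x)) :
      localToFractionRing z.1 (HomogeneousLocalization.mk
        ⟨i x, ⟨a x, ha x⟩, ⟨b x, hb x⟩, hz⟩) = y := by
    refine (localToFractionRing_mk z.1 ⟨i x, ⟨a x, ha x⟩, ⟨b x, hb x⟩, hz⟩).trans ?_
    rw [div_eq_iff (by simpa using ne_zero_of_mem_basicOpen hz)]
    exact (h x).symm
  let s : Γ(ProjSpace k n, U) := ⟨fun x => HomogeneousLocalization.mk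
    ⟨i x, ⟨a x, ha x⟩, ⟨b x, hb x⟩, hx x⟩, fun x => by
      refine ⟨U ⊓ Proj.basicOpen (grading k n) (b x), ⟨x.2, hx x⟩, homOfLE inf_le_left, i x,
        ⟨a x, ha x⟩, ⟨b x, hb x⟩, fun z => z.2.2, fun z => ?_⟩
      refine localToFractionRing_injective z.1 ?_
      exact (key ⟨z.1, z.2.1⟩ ⟨z.1, z.2.1⟩ (hx _)).trans
        (key x ⟨z.1, z.2.1⟩ z.2.2).symm⟩
  exact ⟨s, key ⟨_, hU⟩ ⟨_, hU⟩ (hx _)⟩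

lemma genericValue_map (hn : 1 ≤ n) {U V : (ProjSpace k n).Opens} (hU : genericPt k hn ∈ U)
    (hV : genericPt k hn ∈ V) (i : V ⟶ U) (s : Γ(ProjSpace k n, U)) :
    genericValue hn V hV ((ProjSpace k n).presheaf.map i.op s) = genericValue hn U hU s :=
  rfl

lemma exists_dvd_pow_of_forall_prime_dvd {S : Type*} [CommRing S] [IsDomain S]
    [UniqueFactorizationMonoid S] {g : S} (q : S) (hq : q ≠ 0)
    (h : ∀ p, Prime p → p ∣ q → p ∣ g) : ∃ N : ℕ, q ∣ g ^ N := by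
  induction q using UniqueFactorizationMonoid.induction_on_prime with
  | h₁ => exact absurd rfl hq
  | h₂ q hu => exact ⟨0, hu.dvd⟩
  | h₃ a p ha hp ih =>
    obtain ⟨N, hN⟩ := ih ha fun r hr hra => h r hr (hra.mul_left p)
    refine ⟨N + 1, ?_⟩
    rw [pow_succ']
    exact mul_dvd_mul (h p hp (dvd_mul_right p a)) hN

/-- A rational function is regular on `U` if and only if it is a quotient of two forms of the
same degree with denominator nowhere zero on `U`. -/
lemma mem_range_genericValue_iff (hn : 1 ≤ n) (U : (ProjSpace k n).Opens)
    (hU : genericPt k hn ∈ U) (y : K) :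
    y ∈ (genericValue hn U hU).range ↔ ∃ (i : ℕ) (p q : R), p.IsHomogeneous i ∧
      q.IsHomogeneous i ∧ U ≤ Proj.basicOpen (grading k n) q ∧
      y * algebraMap R K q = algebraMap R K p := by
  constructor
  · rintro ⟨s, rfl⟩
    have hs := exists_eq_of_genericValue hn U hU s
    set y := genericValue hn U hU s
    rcases eq_or_ne y 0 with hy | hy
    · refine ⟨0, 0, 1, isHomogeneous_zero _ _ _, isHomogeneous_one _ _, ?_, by simp [hy]⟩
      rw [Proj.basicOpen_one]
      exact le_top
    obtain ⟨p, q, hpq, hy'⟩ := IsFractionRing.exists_reduced_fraction (A := R) y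
    have hq0 : (q : R) ≠ 0 := nonZeroDivisors.coe_ne_zero q
    have hyq : y * algebraMap R K q = algebraMap R K p := by
      rw [← hy', IsLocalization.mk'_spec]
    have hcross {a b : R} (h : y * algebraMap R K b = algebraMap R K a) : p * b = a * q := by
      apply IsFractionRing.injective R K
      rw [map_mul, map_mul, ← h, ← hyq]
      ring
    have hdvd {a b : R} (h : y * algebraMap R K b = algebraMap R K a) : (q : R) ∣ b :=
      hpq.symm.dvd_of_dvd_mul_left ⟨a, by rw [hcross h, mul_comm]⟩
    obtain ⟨i, a, b, ha, hb, hx, h⟩ := hs ⟨_, hU⟩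
    have hb0 : b ≠ 0 := ne_zero_of_mem_basicOpen hx
    have ha0 : a ≠ 0 := by
      rintro rfl
      simp [hy, hb0] at h
    have hp0 : p ≠ 0 := by
      rintro rfl
      simp [hy, hq0] at hyq
    obtain ⟨j, hj⟩ := hb.of_dvd hb0 (hdvd h)
    obtain ⟨l, hl⟩ := ha.of_dvd ha0 (hpq.dvd_of_dvd_mul_right ⟨b, (hcross h).symm⟩)
    have hjl : l + i = i + j :=
      (hl.mul hb).inj_right (by simpa [hcross h] using ha.mul hj) (mul_ne_zero hp0 hb0)
    obtain rfl : l = j := by lia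
    refine ⟨l, p, q, hl, hj, fun x hx => ?_, hyq⟩
    obtain ⟨i, a, b, -, -, hxb, h⟩ := hs ⟨x, hx⟩
    exact Proj.basicOpen_mono _ _ _ (hdvd h) hxb
  · rintro ⟨i, p, q, hp, hq, hUq, h⟩
    exact exists_genericValue_eq hn U hU y fun x => ⟨i, p, q, hp, hq, hUq x.2, h⟩

lemma dvd_of_basicOpen_le (hn : 1 ≤ n) {f p : R} {i : ℕ} (hp : Prime p)
    (hpi : p.IsHomogeneous i)
    (h : Proj.basicOpen (grading k n) f ≤ Proj.basicOpen (grading k n) p) : p ∣ f := by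
  by_contra hpf
  have hx : (pointOfPrime hn p hpi (Or.inr hp) : ProjSpace k n) ∈
      Proj.basicOpen (grading k n) f :=
    fun hf => hpf ((mem_pointOfPrime hn hpi (Or.inr hp) f).1 hf)
  exact h hx ((mem_pointOfPrime hn hpi (Or.inr hp) p).2 dvd_rfl)

lemma mem_range_genericValue_iff_mem_degreeZeroAway (hn : 1 ≤ n) (U : (ProjSpace k n).Opens)
    (hU : genericPt k hn ∈ U) {g : R} {e : ℕ} (hg : Prime g) (hge : g.IsHomogeneous e)
    (hUg : U ≤ Proj.basicOpen (grading k n) g)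
    (h : ∀ (p : R) (i : ℕ), Prime p → p.IsHomogeneous i →
      U ≤ Proj.basicOpen (grading k n) p → p ∣ g) (y : K) :
    y ∈ (genericValue hn U hU).range ↔ y ∈ degreeZeroAway g e := by
  rw [mem_range_genericValue_iff]
  constructor
  · rintro ⟨i, p, q, hp, hq, hUq, hy⟩
    have hq0 : q ≠ 0 := ne_zero_of_mem_basicOpen (hUq hU)
    obtain ⟨N, hN⟩ := exists_dvd_pow_of_forall_prime_dvd q hq0 (g := g) fun r hr hrq => by
      obtain ⟨j, hj⟩ := hq.of_dvd hq0 hrq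
      exact h r j hr hj (hUq.trans (Proj.basicOpen_mono _ _ _ hrq))
    obtain ⟨c, m, hc, rfl⟩ := eq_C_mul_pow_of_dvd_pow hg hN
    have hi : i = e * m :=
      hq.inj_right (by simpa using (isHomogeneous_C _ c).mul (hge.pow m)) hq0
    refine ⟨m, C c⁻¹ * p, ?_, ?_⟩
    · simpa [← hi] using (isHomogeneous_C _ c⁻¹).mul hp
    · rw [map_mul, ← hy, map_mul, map_pow]
      have : algebraMap R K (C c⁻¹) * algebraMap R K (C c) = 1 := by
        rw [← map_mul, ← map_mul, inv_mul_cancel₀ hc, map_one, map_one]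
      linear_combination (- y * algebraMap R K g ^ m) * this
  · rintro ⟨j, a, ha, hy⟩
    refine ⟨e * j, a, g ^ j, ha, hge.pow j, fun x hx hgx => ?_, by rw [map_pow, hy]⟩
    exact hUg hx (x.isPrime.mem_of_pow_mem _ hgx)

lemma mem_range_genericValue_basicOpen_iff (hn : 1 ≤ n) {g : R} {e : ℕ} (hg : Prime g)
    (hge : g.IsHomogeneous e) (y : K) :
    y ∈ (genericValue hn _ (genericPt_mem_basicOpen hn hg.ne_zero)).range ↔
      y ∈ degreeZeroAway g e :=
  mem_range_genericValue_iff_mem_degreeZeroAway hn _ _ hg hge le_rfl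
    (fun _ _ hp hpi h => dvd_of_basicOpen_le hn hp hpi h) y

lemma exists_eq_C_of_mul_eq_one {f : R} {d : ℕ} (hd : 1 ≤ d) (hf : Prime f)
    (hfd : f.IsHomogeneous d) {y z : K} (hy : y ∈ degreeZeroAway f d)
    (hz : z ∈ degreeZeroAway f d) (h : y * z = 1) : ∃ c, y = algebraMap R K (C c) := by
  obtain ⟨j, a, ha, hya⟩ := hy
  obtain ⟨l, b, hb, hzb⟩ := hz
  have hf0 : algebraMap R K f ≠ 0 := by simpa using hf.ne_zero
  have hab : f ^ (j + l) = a * b := by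
    apply IsFractionRing.injective R K
    rw [map_mul, ← hya, ← hzb, map_pow, pow_add]
    linear_combination (- algebraMap R K f ^ j * algebraMap R K f ^ l) * h
  obtain ⟨c, m, hc, rfl⟩ := eq_C_mul_pow_of_dvd_pow hf ⟨b, hab⟩
  have hm : d * m = d * j :=
    (by simpa using (isHomogeneous_C _ c).mul (hfd.pow m) : IsHomogeneous _ (d * m)).inj_right ha
      (mul_ne_zero (by simpa using hc) (pow_ne_zero _ hf.ne_zero))
  obtain rfl : m = j := Nat.eq_of_mul_eq_mul_left (by lia) hm
  refine ⟨c, mul_right_cancel₀ (pow_ne_zero m hf0) ?_⟩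
  rw [hya, map_mul, map_pow]

lemma exists_mem_degreeZeroAway_ne_C (hn : 1 ≤ n) {f : R} {d : ℕ} (hd : 1 ≤ d) (hf : f ≠ 0) :
    ∃ y ∈ degreeZeroAway f d, ∀ c, y ≠ algebraMap R K (C c) := by
  by_contra! H
  have key (u : R) (hu : u.IsHomogeneous 1) : ∃ c, u ^ d = C c * f := by
    obtain ⟨c, hc⟩ := H _ (div_pow_mem_degreeZeroAway (e := d) hf hu)
    refine ⟨c, IsFractionRing.injective R K ?_⟩
    rw [div_eq_iff (by simpa using hf)] at hc
    simpa using hc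
  obtain ⟨c, hc⟩ := key (X 0) (isHomogeneous_X _ _)
  obtain ⟨c', hc'⟩ := key (X 1) (isHomogeneous_X _ _)
  have hc0 : c ≠ 0 := by
    rintro rfl
    simp at hc
  refine not_X_zero_dvd_X_one (k := k) hn (X_prime.dvd_of_dvd_pow (n := d) ?_)
  refine (dvd_pow_self (X 0 : R) (by lia : d ≠ 0)).trans ⟨C (c' * c⁻¹), ?_⟩
  rw [hc, hc']
  calc C c' * f = C (c * (c' * c⁻¹)) * f := by field_simp
    _ = _ := by rw [map_mul]; ring

lemma MvPolynomial.IsHomogeneous.exists_eq_C {p : R} (hp : p.IsHomogeneous 0) : ∃ c, p = C c :=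
  ⟨_, totalDegree_eq_zero_iff_eq_C.1 ((totalDegree_zero_iff_isHomogeneous _).2 hp)⟩

lemma C_mem_degreeZeroAway (f : R) (d : ℕ) (c : k) : algebraMap R K (C c) ∈ degreeZeroAway f d :=
  ⟨0, C c, by simpa using isHomogeneous_C _ c, by simp⟩

/-- If the ring of regular functions on `U` is isomorphic to that of the complement of a prime form
`f`, then it equals that of the complement of a prime form of the same degree. -/
theorem exists_prime_of_ringEquiv_range (hn : 1 ≤ n) {f : R} {d : ℕ} (hd : 1 ≤ d) (hf : Prime f)
    (hfd : f.IsHomogeneous d) (U : (ProjSpace k n).Opens) (hU : genericPt k hn ∈ U)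
    (φ : (genericValue hn _ (genericPt_mem_basicOpen hn hf.ne_zero)).range ≃+*
      (genericValue hn U hU).range)
    (hφ : ∀ (c : k) (s : (genericValue hn _ (genericPt_mem_basicOpen hn hf.ne_zero)).range),
      (s : K) = algebraMap R K (C c) → (φ s : K) = algebraMap R K (C c)) :
    ∃ g : R, Prime g ∧ g.IsHomogeneous d ∧ U ≤ Proj.basicOpen (grading k n) g ∧
      ∀ y, y ∈ (genericValue hn U hU).range ↔ y ∈ degreeZeroAway g d := by
  have hS := mem_range_genericValue_basicOpen_iff hn hf hfd
  have hconst (c : k) (s : (genericValue hn _ (genericPt_mem_basicOpen hn hf.ne_zero)).range)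
      (h : (φ s : K) = algebraMap R K (C c)) : (s : K) = algebraMap R K (C c) := by
    have : φ s = φ ⟨_, (hS _).2 (C_mem_degreeZeroAway f d c)⟩ :=
      Subtype.ext (h.trans (hφ c _ rfl).symm)
    rw [φ.injective this]
  have hdeg {p : R} {i : ℕ} (hp : Prime p) (hpi : p.IsHomogeneous i) : 1 ≤ i := by
    rw [Nat.one_le_iff_ne_zero]
    rintro rfl
    obtain ⟨c, rfl⟩ := hpi.exists_eq_C
    exact hp.not_isUnit ((IsUnit.mk0 c (by simpa using hp.ne_zero)).map C)
  have hprime : ∃ (g : R) (e : ℕ), Prime g ∧ g.IsHomogeneous e ∧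
      U ≤ Proj.basicOpen (grading k n) g := by
    by_contra! H
    obtain ⟨y, hy, hyc⟩ := exists_mem_degreeZeroAway_ne_C hn hd hf.ne_zero
    obtain ⟨i, p, q, hp, hq, hUq, h⟩ :=
      (mem_range_genericValue_iff hn U hU _).1 (φ ⟨y, (hS y).2 hy⟩).2
    have hq0 : q ≠ 0 := ne_zero_of_mem_basicOpen (hUq hU)
    have hqu : IsUnit q := by
      by_contra hqu
      obtain ⟨r, hr, hrq⟩ := WfDvdMonoid.exists_irreducible_factor hqu hq0
      obtain ⟨j, hj⟩ := hq.of_dvd hq0 hrq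
      exact H r j hr.prime hj (hUq.trans (Proj.basicOpen_mono _ _ _ hrq))
    obtain ⟨c, hc, rfl⟩ := isUnit_iff_eq_C_of_isReduced.1 hqu
    obtain rfl : i = 0 := hq.inj_right (isHomogeneous_C _ c) hq0
    obtain ⟨c', rfl⟩ := hp.exists_eq_C
    refine hyc (c' * c⁻¹) (hconst _ ⟨y, (hS y).2 hy⟩ ?_)
    rw [eq_comm, map_mul, map_mul, ← h, mul_assoc, ← map_mul, ← map_mul,
      mul_inv_cancel₀ hc.ne_zero, map_one, map_one, mul_one]
  obtain ⟨g, e, hg, hge, hUg⟩ := hprime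
  have hT : ∀ y, y ∈ (genericValue hn U hU).range ↔ y ∈ degreeZeroAway g e := by
    refine mem_range_genericValue_iff_mem_degreeZeroAway hn U hU hg hge hUg
      fun p i hp hpi hUp => ?_
    have hp0 : algebraMap R K p ≠ 0 := by simpa using hp.ne_zero
    have hg0 : algebraMap R K g ≠ 0 := by simpa using hg.ne_zero
    let y : (genericValue hn U hU).range := ⟨algebraMap R K p ^ e / algebraMap R K g ^ i,
      (mem_range_genericValue_iff hn U hU _).2 ⟨i * e, p ^ e, g ^ i, hpi.pow e,
        by simpa [mul_comm] using hge.pow i,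
        fun x hx hgx => hUg hx (x.isPrime.mem_of_pow_mem _ hgx), by
          rw [map_pow, map_pow]; field_simp⟩⟩
    let z : (genericValue hn U hU).range := ⟨algebraMap R K g ^ i / algebraMap R K p ^ e,
      (mem_range_genericValue_iff hn U hU _).2 ⟨i * e, g ^ i, p ^ e,
        by simpa [mul_comm] using hge.pow i, hpi.pow e,
        fun x hx hgx => hUp hx (x.isPrime.mem_of_pow_mem _ hgx), by
          rw [map_pow, map_pow]; field_simp⟩⟩
    have hyz : y * z = 1 := by
      apply Subtype.ext
      simp only [y, z, Subring.coe_mul, Subring.coe_one]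
      field_simp
    obtain ⟨c, hc⟩ := exists_eq_C_of_mul_eq_one hd hf hfd ((hS _).1 (φ.symm y).2)
      ((hS _).1 (φ.symm z).2) (by
        rw [← Subring.coe_mul, ← map_mul, hyz, map_one, Subring.coe_one])
    have hyc := hφ c _ hc
    rw [RingEquiv.apply_symm_apply, div_eq_iff (pow_ne_zero _ hg0), ← map_pow, ← map_pow,
      ← map_mul] at hyc
    have hpg : p ∣ C c * g ^ i := by
      rw [← IsFractionRing.injective R K hyc]
      exact dvd_pow_self p (by have := hdeg hg hge; lia)
    rcases eq_or_ne c 0 with rfl | hc0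
    · exact absurd (IsFractionRing.injective R K hyc) (by simp [hp.ne_zero])
    · refine hp.dvd_of_dvd_pow ((IsUnit.dvd_mul_left ?_).1 hpg)
      exact (IsUnit.mk0 c hc0).map C
  have hde : d = e := Nat.dvd_antisymm
    (dvd_of_ringEquiv_degreeZeroAway hn hd hf hfd hg.ne_zero hge hS hT φ)
    (dvd_of_ringEquiv_degreeZeroAway hn (hdeg hg hge) hg hge hf.ne_zero hfd hT hS φ.symm)
  subst hde
  exact ⟨g, hg, hge, hUg, hT⟩

/-- The constant regular function `c` on an open subscheme of `ℙⁿ`. -/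
def constSection (U : (ProjSpace k n).Opens) (c : k) : Γ(ProjSpace k n, U) :=
  U.topIso.hom ((U.ι ≫ projStruct k n).appTop ((Scheme.ΓSpecIso (.of k)).inv c))

lemma constSection_eq_map (U : (ProjSpace k n).Opens) (c : k) :
    constSection U c = (ProjSpace k n).presheaf.map (homOfLE le_top).op
      ((projStruct k n).appTop ((Scheme.ΓSpecIso (.of k)).inv c)) := by
  rfl

lemma genericValue_constSection (hn : 1 ≤ n) (U : (ProjSpace k n).Opens)
    (hU : genericPt k hn ∈ U) (c : k) :
    genericValue hn U hU (constSection U c) = algebraMap R K (C c) := by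
  let D := Proj.basicOpen (grading k n) (X 0)
  have hD : genericPt k hn ∈ D := genericPt_mem_basicOpen hn (X_ne_zero 0)
  have h1 : genericValue hn U hU (constSection U c) = genericValue hn D hD (constSection D c) := by
    rw [constSection_eq_map, constSection_eq_map]
    rfl
  have h2 : D.ι ≫ projStruct k n = Proj.basicOpenToSpec (grading k n) (X 0) ≫
      Spec.map (CommRingCat.ofHom ((HomogeneousLocalization.fromZeroRingHom (grading k n) _).comp
        (algebraMap k ((grading k n) 0)))) := by
    have h3 := Proj.awayι_toSpecZero (grading k n) (f := X 0)
      ((mem_homogeneousSubmodule _ _).2 (isHomogeneous_X k (0 : Fin (n + 1)))) one_pos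
    rw [Proj.awayι, Category.assoc, Iso.inv_comp_eq, Proj.basicOpenIsoSpec_hom] at h3
    rw [projStruct, reassoc_of% h3, ← Spec.map_comp, ← CommRingCat.ofHom_comp]
  have h3 : (Proj.basicOpenToSpec (grading k n) (X 0)).appTop = (Scheme.ΓSpecIso _).hom ≫
      Proj.awayToSection (grading k n) (X 0) ≫ D.topIso.inv :=
    Proj.basicOpenToSpec_app_top (grading k n) (X 0)
  have h4 : (Scheme.ΓSpecIso (.of k)).inv ≫ (D.ι ≫ projStruct k n).appTop ≫ D.topIso.hom =
      CommRingCat.ofHom ((HomogeneousLocalization.fromZeroRingHom (grading k n) _).comp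
        (algebraMap k ((grading k n) 0))) ≫ Proj.awayToSection (grading k n) (X 0) := by
    rw [h2, Scheme.Hom.comp_appTop, h3, Category.assoc, ← Scheme.ΓSpecIso_inv_naturality_assoc,
      Category.assoc, Category.assoc, Iso.inv_hom_id, Category.comp_id, Iso.inv_hom_id_assoc]
  have h5 : constSection D c = Proj.awayToSection (grading k n) (X 0)
      (HomogeneousLocalization.fromZeroRingHom (grading k n) _
        (algebraMap k ((grading k n) 0) c)) := by
    have h6 := ConcreteCategory.congr_hom h4 c
    rw [CommRingCat.comp_apply, CommRingCat.comp_apply, CommRingCat.comp_apply] at h6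
    exact h6
  rw [h1, h5]
  refine (localToFractionRing_mk (genericPt k hn) _).trans ?_
  change algebraMap R K (algebraMap k ((grading k n) 0) c : R) / algebraMap R K 1 = _
  rw [map_one, div_one]
  rfl

lemma exists_ringEquiv_of_isoOver (hn : 1 ≤ n) {U V : (ProjSpace k n).Opens}
    (hU : genericPt k hn ∈ U) (hV : genericPt k hn ∈ V)
    (h : IsoOver (U.ι ≫ projStruct k n) (V.ι ≫ projStruct k n)) :
    ∃ φ : (genericValue hn U hU).range ≃+* (genericValue hn V hV).range,
      ∀ (c : k) (s : (genericValue hn U hU).range),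
        (s : K) = algebraMap R K (C c) → (φ s : K) = algebraMap R K (C c) := by
  obtain ⟨e, he⟩ := h
  have he' : e.inv ≫ U.ι ≫ projStruct k n = V.ι ≫ projStruct k n := by
    rw [← he, e.inv_hom_id_assoc]
  have : IsIso e.inv.appTop := inferInstanceAs (IsIso (e.inv.app ⊤))
  let ψ : Γ(ProjSpace k n, U) ≅ Γ(ProjSpace k n, V) :=
    U.topIso.symm ≪≫ asIso e.inv.appTop ≪≫ V.topIso
  have hψ (c : k) : ψ.hom (constSection U c) = constSection V c := by
    have h1 : (U.ι ≫ projStruct k n).appTop ≫ U.topIso.hom ≫ ψ.hom =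
        (V.ι ≫ projStruct k n).appTop ≫ V.topIso.hom := by
      simp only [ψ, Iso.trans_hom, Iso.symm_hom, asIso_hom, Iso.hom_inv_id_assoc]
      rw [← he', Scheme.Hom.comp_appTop e.inv, Category.assoc]
    have h2 := ConcreteCategory.congr_hom h1 ((Scheme.ΓSpecIso (.of k)).inv c)
    rw [CommRingCat.comp_apply, CommRingCat.comp_apply, CommRingCat.comp_apply] at h2
    exact h2
  let αU := RingEquiv.ofBijective (genericValue hn U hU).rangeRestrict
    ⟨fun a b hab => genericValue_injective hn U hU (congrArg Subtype.val hab),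
      RingHom.rangeRestrict_surjective _⟩
  let αV := RingEquiv.ofBijective (genericValue hn V hV).rangeRestrict
    ⟨fun a b hab => genericValue_injective hn V hV (congrArg Subtype.val hab),
      RingHom.rangeRestrict_surjective _⟩
  refine ⟨αU.symm.trans (ψ.commRingCatIsoToRingEquiv.trans αV), fun c s hs => ?_⟩
  obtain ⟨t, rfl⟩ := αU.surjective s
  obtain rfl : t = constSection U c :=
    genericValue_injective hn U hU (hs.trans (genericValue_constSection hn U hU c).symm)
  rw [RingEquiv.trans_apply, RingEquiv.symm_apply_apply, RingEquiv.trans_apply]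
  refine Eq.trans ?_ (genericValue_constSection hn V hV c)
  exact congrArg (genericValue hn V hV) (hψ c)

lemma eq_of_range_genericValue_eq (hn : 1 ≤ n) {U V : (ProjSpace k n).Opens}
    (hU : genericPt k hn ∈ U) (hUV : U ≤ V) (hUa : IsAffineOpen U) (hVa : IsAffineOpen V)
    (h : (genericValue hn U hU).range ≤ (genericValue hn V (hUV hU)).range) : U = V := by
  have : IsAffine U.toScheme := hUa
  have : IsAffine V.toScheme := hVa
  have hmap := genericValue_map hn (hUV hU) hU (homOfLE hUV)
  have hbij : Function.Bijective ((ProjSpace k n).presheaf.map (homOfLE hUV).op) := by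
    constructor
    · intro s t hst
      apply genericValue_injective hn V (hUV hU)
      rw [← hmap s, hst, hmap t]
    · intro s
      obtain ⟨t, ht⟩ := h ⟨s, rfl⟩
      exact ⟨t, genericValue_injective hn U hU ((hmap t).trans ht)⟩
  have h1 : IsIso ((ProjSpace k n).presheaf.map (homOfLE hUV).op) :=
    (ConcreteCategory.isIso_iff_bijective _).2 hbij
  have h2 : IsIso ((ProjSpace k n).homOfLE hUV).appTop := by
    have : ((ProjSpace k n).homOfLE hUV).appTop =
        V.topIso.hom ≫ (ProjSpace k n).presheaf.map (homOfLE hUV).op ≫ U.topIso.inv := by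
      rw [Scheme.homOfLE_appTop]
      rfl
    rw [this]
    infer_instance
  have h3 : IsIso ((ProjSpace k n).homOfLE hUV) := by
    have : IsIso ((ProjSpace k n).homOfLE hUV ≫ V.toScheme.isoSpec.hom) := by
      rw [← Scheme.isoSpec_hom_naturality]
      infer_instance
    exact IsIso.of_isIso_comp_right _ V.toScheme.isoSpec.hom
  have h4 := Scheme.opensRange_homOfLE (X := ProjSpace k n) hUV
  rw [Scheme.Hom.opensRange_of_isIso] at h4
  exact le_antisymm hUV fun x hx => (h4.le trivial : (⟨x, hx⟩ : V) ∈ V.ι ⁻¹ᵁ U)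

end ProjectiveSpace

/-- **Lemma 2.6.**  Let `f ∈ k[x_0, …, x_n]` be an irreducible homogeneous polynomial of
degree `d ≥ 1` and let `U ⊆ ℙⁿ_k` be an open subvariety.  If `ℙⁿ_f ≅ U` (over `k`),
then there is an irreducible homogeneous polynomial `g` of degree `d` with `U = ℙⁿ_g`. -/
theorem stmt5 (k : Type) [Field k] (n d : ℕ) (hn : 1 ≤ n) (hd : 1 ≤ d)
    (f : MvPolynomial (Fin (n + 1)) k)
    (hf : Irreducible f) (hfd : f.IsHomogeneous d)
    (U : (ProjSpace k n).Opens)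
    (hiso : IsoOver (PnFStruct k n f) (U.ι ≫ projStruct k n)) :
    ∃ g : MvPolynomial (Fin (n + 1)) k,
      Irreducible g ∧ g.IsHomogeneous d ∧ U = Proj.basicOpen (grading k n) g := by
  have hfp : Prime f := hf.prime
  have hD := genericPt_mem_basicOpen hn hfp.ne_zero
  have hU : genericPt k hn ∈ U := by
    obtain ⟨e, -⟩ := hiso
    exact genericPt_mem hn (e.hom.base ⟨_, hD⟩).2
  have hUa : IsAffineOpen U := by
    obtain ⟨e, -⟩ := hiso
    have : IsAffine (PnF k n f) := Proj.isAffineOpen_basicOpen (grading k n) f hfd hd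
    exact IsAffine.of_isIso e.inv
  obtain ⟨φ, hφ⟩ := exists_ringEquiv_of_isoOver hn hD hU hiso
  obtain ⟨g, hg, hgd, hUg, hrange⟩ := exists_prime_of_ringEquiv_range hn hd hfp hfd U hU φ hφ
  refine ⟨g, hg.irreducible, hgd, eq_of_range_genericValue_eq hn hU hUg hUa
    (Proj.isAffineOpen_basicOpen (grading k n) g hgd hd) fun y hy => ?_⟩
  exact (mem_range_genericValue_basicOpen_iff hn hg hgd y).2 ((hrange y).1 hy)

end
end

section
/- Let k be a field, let d ≥ 4 be an integer, and let f, g ∈ k[x, y, z] be the homogeneous polynomials of degree d defined by f = x^{d−1} y + z^d and g = x^{d−1} y + z^d + d x^{d−2} z^2. Then for each r ≥ 1, the open subvarieties P^{r+2}_f and P^{r+2}_g of P^{r+2}_k are isomorphic. -/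
/-!
Common set-up: projective `n`-space over a field `k` as the scheme
`Proj k[x_0, …, x_n]`, complements of hypersurfaces as open subschemes,
hypersurfaces as reduced closed subschemes, and isomorphisms of varieties
over `k` as scheme isomorphisms commuting with the structure morphisms
to `Spec k`.
-/

open AlgebraicGeometry CategoryTheory MvPolynomial

attribute [local instance] MvPolynomial.gradedAlgebra

noncomputable section

section HomogeneousFractions

variable {k : Type} [Field k] {σ : Type}

theorem isHomogeneous_of_X_pow_mul {i : σ} {a n : ℕ} {p : MvPolynomial σ k}
    (hp : (X i ^ a * p).IsHomogeneous (n + a)) : p.IsHomogeneous n := by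
  intro s hs
  have := @hp (s + Finsupp.single i a) (by
    rwa [X_pow_eq_monomial, add_comm, coeff_monomial_mul, one_mul])
  simpa [Finsupp.weight_single] using this

/-- The elements of degree `n` of the localization `k[σ]_h`, for `h` homogeneous of
degree `d`: fractions `P / h ^ m` with `P` homogeneous of degree `n + d * m`. -/
def fractionsOfDegree {h : MvPolynomial σ k} {d : ℕ} (hh : h.IsHomogeneous d) (n : ℕ) :
    Submodule k (Localization.Away h) where
  carrier := {u | ∃ (m : ℕ) (P : MvPolynomial σ k), P.IsHomogeneous (n + d * m) ∧
    u * algebraMap _ (Localization.Away h) h ^ m = algebraMap _ _ P}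
  zero_mem' := ⟨0, 0, isHomogeneous_zero _ _ _, by simp⟩
  add_mem' := by
    rintro u v ⟨m, P, hP, hu⟩ ⟨m', Q, hQ, hv⟩
    refine ⟨m + m', P * h ^ m' + Q * h ^ m, ?_, ?_⟩
    · refine .add ?_ ?_
      · convert hP.mul (hh.pow m') using 1; ring
      · convert hQ.mul (hh.pow m) using 1; ring
    · simp only [map_add, map_mul, map_pow, ← hu, ← hv]; ring
  smul_mem' := by
    rintro c u ⟨m, P, hP, hu⟩
    refine ⟨m, c • P, (homogeneousSubmodule σ k _).smul_mem c hP, ?_⟩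
    rw [smul_mul_assoc, hu]
    exact (map_smul (IsScalarTower.toAlgHom k (MvPolynomial σ k) (Localization.Away h)) c P).symm

variable {h h' : MvPolynomial σ k} {d : ℕ} (hh : h.IsHomogeneous d) (hh' : h'.IsHomogeneous d)

theorem algebraMap_mem_fractionsOfDegree {n : ℕ} {P : MvPolynomial σ k}
    (hP : P.IsHomogeneous n) : algebraMap _ (Localization.Away h) P ∈ fractionsOfDegree hh n :=
  ⟨0, P, by simpa using hP, by simp⟩

theorem mul_mem_fractionsOfDegree {m n : ℕ} {u v : Localization.Away h}
    (hu : u ∈ fractionsOfDegree hh m) (hv : v ∈ fractionsOfDegree hh n) :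
    u * v ∈ fractionsOfDegree hh (m + n) := by
  obtain ⟨a, P, hP, hu⟩ := hu
  obtain ⟨b, Q, hQ, hv⟩ := hv
  refine ⟨a + b, P * Q, ?_, ?_⟩
  · convert hP.mul hQ using 1; ring
  · simp only [map_mul, ← hu, ← hv]; ring

theorem one_mem_fractionsOfDegree : 1 ∈ fractionsOfDegree hh 0 := by
  simpa using algebraMap_mem_fractionsOfDegree hh (isHomogeneous_one σ k)

instance : SetLike.GradedMonoid (fractionsOfDegree hh) where
  one_mem := one_mem_fractionsOfDegree hh
  mul_mem _ _ _ _ := mul_mem_fractionsOfDegree hh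

theorem mem_fractionsOfDegree_of_mul_self {n : ℕ} {u : Localization.Away h}
    (hu : u * algebraMap _ _ h ∈ fractionsOfDegree hh (n + d)) :
    u ∈ fractionsOfDegree hh n := by
  obtain ⟨m, P, hP, hu⟩ := hu
  refine ⟨m + 1, P, ?_, ?_⟩
  · convert hP using 1; ring
  · rw [← hu]; ring

theorem algebraMap_away_injective (h0 : h ≠ 0) :
    Function.Injective (algebraMap (MvPolynomial σ k) (Localization.Away h)) :=
  IsLocalization.injective _ (powers_le_nonZeroDivisors_of_noZeroDivisors h0)

theorem mem_fractionsOfDegree_of_X_pow_mul (h0 : h ≠ 0) {i : σ} {a n : ℕ}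
    {u : Localization.Away h}
    (hu : algebraMap (MvPolynomial σ k) _ (X i) ^ a * u ∈ fractionsOfDegree hh (n + a)) :
    u ∈ fractionsOfDegree hh n := by
  obtain ⟨m, P, hP, hu⟩ := hu
  obtain ⟨m', Q, hQ⟩ := IsLocalization.Away.surj h u
  have key : X i ^ a * (Q * h ^ m) = P * h ^ m' := by
    apply algebraMap_away_injective h0
    simp only [map_mul, map_pow, ← hu, ← hQ]; ring
  refine ⟨m' + m, Q * h ^ m, isHomogeneous_of_X_pow_mul (i := i) (a := a) ?_, ?_⟩
  · rw [key]
    convert hP.mul (hh.pow m') using 1; ring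
  · simp only [map_mul, map_pow, ← hQ]; ring

theorem aeval_mem_fractionsOfDegree {v : σ → Localization.Away h}
    (hv : ∀ i, v i ∈ fractionsOfDegree hh 1) {n : ℕ} {P : MvPolynomial σ k}
    (hP : P.IsHomogeneous n) : aeval v P ∈ fractionsOfDegree hh n := by
  rw [aeval_def, eval₂_eq]
  refine Submodule.sum_mem _ fun s hs => ?_
  rw [← Algebra.smul_def]
  refine Submodule.smul_mem _ _ ?_
  have := SetLike.prod_pow_mem_graded (fractionsOfDegree hh) (fun _ : σ => 1) v
    (F := s.support) s fun i _ => hv i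
  convert this using 1
  rw [← hP (mem_support_iff.mp hs)]
  simp [Finsupp.weight_apply, Finsupp.sum]

theorem mem_range_val_iff {u : Localization.Away h} :
    (∃ w : HomogeneousLocalization.Away (homogeneousSubmodule σ k) h, w.val = u) ↔
      u ∈ fractionsOfDegree hh 0 := by
  have hmem : h ∈ homogeneousSubmodule σ k d := hh
  constructor
  · rintro ⟨w, rfl⟩
    obtain ⟨n, P, hP, rfl⟩ := HomogeneousLocalization.Away.mk_surjective
      (homogeneousSubmodule σ k) hmem w
    refine ⟨n, P, ?_, ?_⟩
    · convert hP using 1; simp [mul_comm]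
    · rw [HomogeneousLocalization.Away.val_mk, Localization.mk_eq_mk', ← map_pow]
      exact IsLocalization.mk'_spec _ _ _
  · rintro ⟨m, P, hP, hu⟩
    have hP' : P ∈ homogeneousSubmodule σ k (m • d) := by
      rw [mem_homogeneousSubmodule]
      convert hP using 1
      simp [mul_comm]
    refine ⟨.mk _ hmem m P hP', ?_⟩
    rw [HomogeneousLocalization.Away.val_mk, Localization.mk_eq_mk', eq_comm,
      IsLocalization.eq_mk'_iff_mul_eq, map_pow, hu]

theorem map_mem_fractionsOfDegree (φ : Localization.Away h →ₐ[k] Localization.Away h')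
    (hφ : φ (algebraMap _ (Localization.Away h) h) = algebraMap _ (Localization.Away h') h')
    (hX : ∀ i, φ (algebraMap (MvPolynomial σ k) _ (X i)) ∈ fractionsOfDegree hh' 1) {n : ℕ}
    {u : Localization.Away h} (hu : u ∈ fractionsOfDegree hh n) :
    φ u ∈ fractionsOfDegree hh' n := by
  obtain ⟨m, P, hP, hu⟩ := hu
  have hφP : φ (algebraMap _ _ P) =
      aeval (fun i => φ (algebraMap (MvPolynomial σ k) _ (X i))) P := by
    have : φ.comp (IsScalarTower.toAlgHom k _ _) =
        aeval (fun i => φ (algebraMap (MvPolynomial σ k) _ (X i))) := by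
      ext i; simp
    exact DFunLike.congr_fun this P
  obtain ⟨m', Q, hQ, hv⟩ := aeval_mem_fractionsOfDegree hh' hX hP
  refine ⟨m + m', Q, ?_, ?_⟩
  · convert hQ using 1; ring
  · rw [← hv, ← hφP, ← hu, map_mul, map_pow, hφ]; ring

/-- A graded isomorphism `k[σ]_h ≃ k[σ]_h'` restricts to degree zero. -/
def awayEquivOfGraded (φ : Localization.Away h ≃ₐ[k] Localization.Away h')
    (hφ : ∀ u, φ u ∈ fractionsOfDegree hh' 0 ↔ u ∈ fractionsOfDegree hh 0) :
    HomogeneousLocalization.Away (homogeneousSubmodule σ k) h ≃+*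
      HomogeneousLocalization.Away (homogeneousSubmodule σ k) h' :=
  let e (g : MvPolynomial σ k) := RingEquiv.ofBijective
    (algebraMap (HomogeneousLocalization.Away (homogeneousSubmodule σ k) g)
      (Localization.Away g)).rangeRestrict
    ⟨fun _ _ hab => HomogeneousLocalization.val_injective _ (congrArg Subtype.val hab),
      RingHom.rangeRestrict_surjective _⟩
  ((e h).trans ((RingEquiv.subringMap φ.toRingEquiv).trans (RingEquiv.subringCongr (by
    ext u
    have hu : u ∈ fractionsOfDegree hh' 0 ↔ φ.symm u ∈ fractionsOfDegree hh 0 := by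
      simpa using hφ (φ.symm u)
    rw [← mem_range_val_iff, ← mem_range_val_iff] at hu
    constructor
    · rintro ⟨_, ⟨w, rfl⟩, rfl⟩
      exact hu.mpr ⟨w, (φ.symm_apply_apply _).symm⟩
    · intro hw
      obtain ⟨w, hw⟩ := hu.mp hw
      exact ⟨_, ⟨w, hw⟩, φ.apply_symm_apply u⟩)))).trans (e h').symm

theorem val_awayEquivOfGraded (φ : Localization.Away h ≃ₐ[k] Localization.Away h')
    (hφ : ∀ u, φ u ∈ fractionsOfDegree hh' 0 ↔ u ∈ fractionsOfDegree hh 0)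
    (w : HomogeneousLocalization.Away (homogeneousSubmodule σ k) h) :
    (awayEquivOfGraded hh hh' φ hφ w).val = φ w.val := by
  have := RingEquiv.apply_symm_apply (RingEquiv.ofBijective
    (algebraMap (HomogeneousLocalization.Away (homogeneousSubmodule σ k) h')
      (Localization.Away h')).rangeRestrict
    ⟨fun _ _ hab => HomogeneousLocalization.val_injective _ (congrArg Subtype.val hab),
      RingHom.rangeRestrict_surjective _⟩)
  exact congrArg Subtype.val (this _)

end HomogeneousFractions

/-- Graded `k`-isomorphic localizations of `k[x_0, …, x_n]` give isomorphic hypersurface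
complements. -/
theorem isoOver_of_graded {k : Type} [Field k] {n d : ℕ} (hd : 0 < d)
    {h h' : MvPolynomial (Fin (n + 1)) k} (hh : h.IsHomogeneous d) (hh' : h'.IsHomogeneous d)
    (φ : Localization.Away h' ≃ₐ[k] Localization.Away h)
    (hφ : ∀ u, φ u ∈ fractionsOfDegree hh 0 ↔ u ∈ fractionsOfDegree hh' 0) :
    IsoOver (PnFStruct k n h) (PnFStruct k n h') := by
  let e := awayEquivOfGraded hh' hh φ hφ
  let i := Proj.basicOpenIsoSpec (grading k n) h hh hd
  let i' := Proj.basicOpenIsoSpec (grading k n) h' hh' hd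
  let s := Scheme.Spec.mapIso e.toCommRingCatIso.op
  have hi : i.inv ≫ (Proj.basicOpen (grading k n) h).ι ≫ Proj.toSpecZero _ = _ :=
    Proj.awayι_toSpecZero (grading k n) h hh hd
  have hi' : i'.inv ≫ (Proj.basicOpen (grading k n) h').ι ≫ Proj.toSpecZero _ = _ :=
    Proj.awayι_toSpecZero (grading k n) h' hh' hd
  refine ⟨i ≪≫ s ≪≫ i'.symm, ?_⟩
  rw [← cancel_epi i.inv]
  simp only [PnFStruct, projStruct, Iso.trans_hom, Iso.symm_hom, Category.assoc,
    Iso.inv_hom_id_assoc]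
  rw [reassoc_of% hi, reassoc_of% hi']
  simp only [s, Functor.mapIso_hom, Iso.op_hom, Scheme.Spec_map, Quiver.Hom.unop_op,
    ← Spec.map_comp]
  congr 1
  ext c
  refine (val_awayEquivOfGraded hh' hh φ hφ _).trans ?_
  have hC (g : MvPolynomial (Fin (n + 1)) k) : (HomogeneousLocalization.fromZeroRingHom
      (grading k n) (.powers g) (algebraMap k _ c)).val = algebraMap k (Localization.Away g) c := by
    rw [← HomogeneousLocalization.algebraMap_eq,
      IsScalarTower.algebraMap_apply k (MvPolynomial (Fin (n + 1)) k) (Localization.Away g)]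
    rfl
  exact (congrArg φ (hC h')).trans ((φ.commutes c).trans (hC h).symm)

section Twist

variable {k : Type} [Field k] {σ : Type}

/-- The form `x ^ (d - 1) y + z ^ d + a d x ^ (d - 2) z ^ 2` of degree `d = e + 4`. -/
def twistedForm (x y z : σ) (e : ℕ) (a : k) : MvPolynomial σ k :=
  X x ^ (e + 3) * X y + X z ^ (e + 4) + C (a * (e + 4)) * X x ^ (e + 2) * X z ^ 2

theorem twistedForm_isHomogeneous (x y z : σ) (e : ℕ) (a : k) :
    (twistedForm x y z e a).IsHomogeneous (e + 4) := by
  refine .add (.add ?_ ?_) ?_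
  · exact (isHomogeneous_X_pow x (e + 3)).mul (isHomogeneous_X k y)
  · exact isHomogeneous_X_pow z (e + 4)
  · convert ((isHomogeneous_C σ _).mul (isHomogeneous_X_pow x (e + 2))).mul
      (isHomogeneous_X_pow z 2) using 1
    ring

theorem twistedForm_ne_zero {x y z : σ} (hxz : x ≠ z) (hyz : y ≠ z) (e : ℕ) (a : k) :
    twistedForm x y z e a ≠ 0 := by
  classical
  intro h0
  have := congrArg (eval (Function.update (fun _ => (1 : k)) z 0)) h0
  simp [twistedForm, Function.update_of_ne hxz, Function.update_of_ne hyz] at this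

/-- Translating `z` by a multiple of `x ^ (d - 2)` changes the coefficient of `x ^ (d - 2) z ^ 2`
on the locus `h ≠ 0`, modulo `x ^ (d - 1)`. -/
theorem exists_twisted_coordinate {L : Type} [CommRing L] (e : ℕ) {a a' b x y z w h i : L}
    (hab : a' + b = a) (hi : h * i = 1)
    (hh : h = x ^ (e + 3) * y + z ^ (e + 4) + a * (e + 4) * x ^ (e + 2) * z ^ 2) :
    ∃ Y, h = x ^ (e + 3) * Y + (z + x ^ (e + 2) * ((b * z ^ 3 + x ^ 2 * w) * i)) ^ (e + 4) +
      a' * (e + 4) * x ^ (e + 2) * (z + x ^ (e + 2) * ((b * z ^ 3 + x ^ 2 * w) * i)) ^ 2 := by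
  obtain ⟨t, ht⟩ : ∃ t, t = (b * z ^ 3 + x ^ 2 * w) * i := ⟨_, rfl⟩
  rw [← ht]
  obtain ⟨q, hq⟩ := Polynomial.powAddExpansion z (x ^ (e + 2) * t) (e + 4)
  push_cast at hq
  rw [hq]
  obtain ⟨r, hr⟩ : ∃ r, z ^ (e + 3) * t = b * z ^ 2 + x * r := by
    refine ⟨x * w * z ^ (e + 3) * i -
      b * z ^ 2 * i * (x ^ (e + 2) * y + a * (e + 4) * x ^ (e + 1) * z ^ 2), ?_⟩
    rw [ht]
    linear_combination b * z ^ 2 * hi - (b * z ^ 2 * i) * hh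
  refine ⟨y - (e + 4) * r - x ^ (e + 1) * q * t ^ 2 -
    a' * (e + 4) * (2 * z * x ^ (e + 1) * t + x ^ (2 * e + 3) * t ^ 2), ?_⟩
  linear_combination hh - (e + 4) * x ^ (e + 2) * hr - (e + 4) * x ^ (e + 2) * z ^ 2 * hab

theorem map_twistedForm {A : Type*} [CommSemiring A] (f : MvPolynomial σ k →+* A) (x y z : σ)
    (e : ℕ) (a : k) : f (twistedForm x y z e a) = f (X x) ^ (e + 3) * f (X y) + f (X z) ^ (e + 4) +
      f (C (a * (e + 4))) * f (X x) ^ (e + 2) * f (X z) ^ 2 := by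
  rw [twistedForm]
  simp only [map_add f, map_mul f, map_pow f]

variable {x y z w : σ} {e : ℕ} {a a' b : k}

/-- A `k`-algebra map between the localizations at two twisted forms which is a twist by `b` in
the coordinates `z` and `w`. -/
structure IsTwist (x y z w : σ) (e : ℕ) (a' a b : k)
    (φ : Localization.Away (twistedForm x y z e a') →ₐ[k]
      Localization.Away (twistedForm x y z e a)) : Prop where
  map_form : φ (algebraMap _ _ (twistedForm x y z e a')) = algebraMap _ _ (twistedForm x y z e a)
  map_of_ne : ∀ i, i ≠ y → i ≠ z → i ≠ w →
    φ (algebraMap (MvPolynomial σ k) _ (X i)) = algebraMap (MvPolynomial σ k) _ (X i)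
  map_z : φ (algebraMap (MvPolynomial σ k) _ (X z)) * algebraMap _ _ (twistedForm x y z e a) =
    algebraMap _ _ (X z * twistedForm x y z e a + C b * X x ^ (e + 2) * X z ^ 3 +
      X x ^ (e + 4) * X w)
  map_w : algebraMap (MvPolynomial σ k) _ (X x) ^ (e + 4) *
      φ (algebraMap (MvPolynomial σ k) _ (X w)) =
    algebraMap _ _ (twistedForm x y z e a) *
      (algebraMap (MvPolynomial σ k) _ (X z) - φ (algebraMap (MvPolynomial σ k) _ (X z))) +
      algebraMap (MvPolynomial σ k) _ (C b * X x ^ (e + 2)) *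
        φ (algebraMap (MvPolynomial σ k) _ (X z)) ^ 3

theorem exists_isTwist (hxy : x ≠ y) (hxz : x ≠ z) (hxw : x ≠ w) (hyz : y ≠ z) (hyw : y ≠ w)
    (hzw : z ≠ w) (hab : a' + b = a) : ∃ φ, IsTwist x y z w e a' a b φ := by
  classical
  let L := Localization.Away (twistedForm x y z e a)
  let ι : MvPolynomial σ k →ₐ[k] L := IsScalarTower.toAlgHom k _ _
  obtain ⟨i, hi⟩ : ∃ i : L, ι (twistedForm x y z e a) * i = 1 :=
    (IsLocalization.Away.algebraMap_isUnit (S := L) (twistedForm x y z e a)).exists_right_inv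
  have hC (c : k) : ι (C c) = algebraMap k L c := ι.commutes c
  have hh : ι (twistedForm x y z e a) = ι (X x) ^ (e + 3) * ι (X y) + ι (X z) ^ (e + 4) +
      algebraMap k L a * (e + 4) * ι (X x) ^ (e + 2) * ι (X z) ^ 2 := by
    simp [twistedForm, hC, map_ofNat (algebraMap k L)]
  obtain ⟨Y, hY⟩ := exists_twisted_coordinate e (a := algebraMap k L a) (a' := algebraMap k L a')
    (b := algebraMap k L b) (w := ι (X w)) (by rw [← map_add, hab]) hi hh
  obtain ⟨t, ht⟩ : ∃ t, t = (algebraMap k L b * ι (X z) ^ 3 + ι (X x) ^ 2 * ι (X w)) * i :=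
    ⟨_, rfl⟩
  rw [← ht] at hY
  obtain ⟨Z, hZ⟩ : ∃ Z, Z = ι (X z) + ι (X x) ^ (e + 2) * t := ⟨_, rfl⟩
  rw [← hZ] at hY
  let v : σ → L := Function.update (Function.update (Function.update (fun j => ι (X j)) y Y) z Z) w
    (- ι (X w) + algebraMap k L b * ι (X x) ^ e * t * (Z ^ 2 + Z * ι (X z) + ι (X z) ^ 2))
  have vx : v x = ι (X x) := by simp [v, hxy, hxz, hxw]
  have vy : v y = Y := by simp [v, hyz, hyw]
  have vz : v z = Z := by simp [v, hzw]
  have vw : v w = - ι (X w) +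
      algebraMap k L b * ι (X x) ^ e * t * (Z ^ 2 + Z * ι (X z) + ι (X z) ^ 2) := by simp [v]
  have hv : aeval v (twistedForm x y z e a') = ι (twistedForm x y z e a) := by
    rw [hY]; simp [twistedForm, vx, vy, vz, map_ofNat (algebraMap k L)]
  have hunit (u : Submonoid.powers (twistedForm x y z e a')) :
      IsUnit (aeval v (u : MvPolynomial σ k)) := by
    obtain ⟨_, n, rfl⟩ := u
    rw [map_pow, hv]
    exact (IsUnit.of_mul_eq_one i hi).pow n
  let φ : Localization.Away (twistedForm x y z e a') →ₐ[k] L := IsLocalization.liftAlgHom hunit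
  have hφ (P : MvPolynomial σ k) : φ (algebraMap _ _ P) = aeval v P :=
    IsLocalization.lift_eq _ P
  refine ⟨φ, ?_, ?_, ?_, ?_⟩
  · rw [hφ, hv]; rfl
  · intro j h1 h2 h3
    rw [hφ, aeval_X]
    simp only [v, Function.update_of_ne h1, Function.update_of_ne h2, Function.update_of_ne h3]
    rfl
  · rw [hφ, aeval_X, vz]
    change Z * ι _ = ι _
    simp only [map_add, map_mul, map_pow, hC, hZ, ht]
    linear_combination (ι (X x) ^ (e + 2) *
      (algebraMap k L b * ι (X z) ^ 3 + ι (X x) ^ 2 * ι (X w))) * hi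
  · rw [hφ, hφ, aeval_X, aeval_X, vz, vw]
    change ι _ ^ _ * _ = ι _ * (ι _ - Z) + ι _ * Z ^ 3
    have htt : ι (twistedForm x y z e a) * t =
        algebraMap k L b * ι (X z) ^ 3 + ι (X x) ^ 2 * ι (X w) := by
      rw [ht]
      linear_combination (algebraMap k L b * ι (X z) ^ 3 + ι (X x) ^ 2 * ι (X w)) * hi
    simp only [map_mul, map_pow, hC]
    have hZ' : ι (X x) ^ (e + 2) * t = Z - ι (X z) := by rw [hZ]; ring
    linear_combination (ι (X x) ^ (e + 2)) * htt + (-ι (twistedForm x y z e a) +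
      algebraMap k L b * ι (X x) ^ (e + 2) * (Z ^ 2 + Z * ι (X z) + ι (X z) ^ 2)) * hZ'

theorem IsTwist.map_X_mem (hxy : x ≠ y) (hxz : x ≠ z) (hxw : x ≠ w) (hyz : y ≠ z)
    {φ : Localization.Away (twistedForm x y z e a') →ₐ[k]
      Localization.Away (twistedForm x y z e a)} (hφ : IsTwist x y z w e a' a b φ) (i : σ) :
    φ (algebraMap (MvPolynomial σ k) _ (X i)) ∈
      fractionsOfDegree (twistedForm_isHomogeneous x y z e a) 1 := by
  have hh := twistedForm_isHomogeneous x y z e a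
  have h0 : twistedForm x y z e a ≠ 0 := twistedForm_ne_zero hxz hyz e a
  have hX (j : σ) := algebraMap_mem_fractionsOfDegree hh (isHomogeneous_X k j)
  have hmul {m n : ℕ} {u v : Localization.Away (twistedForm x y z e a)} :=
    mul_mem_fractionsOfDegree hh (m := m) (n := n) (u := u) (v := v)
  have hz : φ (algebraMap (MvPolynomial σ k) _ (X z)) ∈ fractionsOfDegree hh 1 := by
    apply mem_fractionsOfDegree_of_mul_self
    rw [hφ.map_z]
    apply algebraMap_mem_fractionsOfDegree
    refine .add (.add ((isHomogeneous_X k z).mul hh) ?_) ?_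
    · convert ((isHomogeneous_C σ b).mul (isHomogeneous_X_pow x (e + 2))).mul
        (isHomogeneous_X_pow z 3) using 1
      ring
    · convert (isHomogeneous_X_pow x (e + 4)).mul (isHomogeneous_X k w) using 1
      ring
  have hpow (n : ℕ) : φ (algebraMap (MvPolynomial σ k) _ (X z)) ^ n ∈ fractionsOfDegree hh n := by
    simpa using SetLike.pow_mem_graded n hz
  have hcx (c : k) (n : ℕ) : algebraMap _ _ (C c * X x ^ n) ∈ fractionsOfDegree hh n := by
    apply algebraMap_mem_fractionsOfDegree
    simpa using (isHomogeneous_C σ c).mul (isHomogeneous_X_pow x n)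
  by_cases hiz : i = z
  · rwa [hiz]
  by_cases hiw : i = w
  · rw [hiw]
    apply mem_fractionsOfDegree_of_X_pow_mul hh h0 (i := x) (a := e + 4)
    rw [hφ.map_w, show 1 + (e + 4) = e + 4 + 1 by ring]
    refine add_mem (hmul (algebraMap_mem_fractionsOfDegree hh hh) (sub_mem (hX z) hz)) ?_
    simpa only [show e + 2 + 3 = e + 4 + 1 by ring] using hmul (hcx b (e + 2)) (hpow 3)
  by_cases hiy : i = y
  · rw [hiy]
    apply mem_fractionsOfDegree_of_X_pow_mul hh h0 (i := x) (a := e + 3)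
    have key := hφ.map_form
    have hx := hφ.map_of_ne x hxy hxz hxw
    have : algebraMap (MvPolynomial σ k) _ (X x) ^ (e + 3) *
        φ (algebraMap (MvPolynomial σ k) _ (X y)) =
        algebraMap _ _ (twistedForm x y z e a) - φ (algebraMap (MvPolynomial σ k) _ (X z)) ^ (e + 4)
        - algebraMap _ _ (C (a' * (e + 4)) * X x ^ (e + 2)) *
          φ (algebraMap (MvPolynomial σ k) _ (X z)) ^ 2 := by
      have hC : φ (algebraMap (MvPolynomial σ k) _ (C (a' * (e + 4)))) =
          algebraMap (MvPolynomial σ k) _ (C (a' * (e + 4))) := φ.commutes _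
      rw [map_twistedForm] at key
      simp only [map_add φ, map_mul φ, map_pow φ, hx, hC] at key
      rw [map_mul, map_pow]
      linear_combination key
    rw [this, add_comm 1]
    refine sub_mem (sub_mem (algebraMap_mem_fractionsOfDegree hh hh) (hpow _)) ?_
    simpa only [show e + 2 + 2 = e + 3 + 1 by ring] using
      hmul (hcx (a' * (e + 4)) (e + 2)) (hpow 2)
  · rw [hφ.map_of_ne i hiy hiz hiw]
    exact hX i

theorem IsTwist.comp_eq_id (hxy : x ≠ y) (hxz : x ≠ z) (hxw : x ≠ w) (hyz : y ≠ z)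
    {φ : Localization.Away (twistedForm x y z e a') →ₐ[k]
      Localization.Away (twistedForm x y z e a)} (hφ : IsTwist x y z w e a' a b φ)
    {ψ : Localization.Away (twistedForm x y z e a) →ₐ[k]
      Localization.Away (twistedForm x y z e a')} (hψ : IsTwist x y z w e a a' (-b) ψ) :
    ψ.comp φ = .id k _ := by
  have h0 : twistedForm x y z e a' ≠ 0 := twistedForm_ne_zero hxz hyz e a'
  have : IsDomain (Localization.Away (twistedForm x y z e a')) :=
    IsLocalization.isDomain_localization (powers_le_nonZeroDivisors_of_noZeroDivisors h0)
  have hinj := algebraMap_away_injective h0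
  have hne {P : MvPolynomial σ k} (hP : P ≠ 0) :
      algebraMap _ (Localization.Away (twistedForm x y z e a')) P ≠ 0 :=
    (map_ne_zero_iff _ hinj).mpr hP
  have hC (c : k) : φ (algebraMap (MvPolynomial σ k) _ (C c)) =
      algebraMap (MvPolynomial σ k) _ (C c) :=
    φ.commutes c
  have hC' (c : k) : ψ (algebraMap (MvPolynomial σ k) _ (C c)) =
      algebraMap (MvPolynomial σ k) _ (C c) :=
    ψ.commutes c
  have hx := hφ.map_of_ne x hxy hxz hxw
  have hx' := hψ.map_of_ne x hxy hxz hxw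
  have hform := hφ.map_form
  have hform' := hψ.map_form
  have hz : ψ (φ (algebraMap (MvPolynomial σ k) _ (X z))) =
      algebraMap (MvPolynomial σ k) _ (X z) := by
    have h1 := congrArg ψ hφ.map_z
    have h2 := hψ.map_w
    apply mul_right_cancel₀ (hne h0)
    simp only [map_add, map_mul, map_pow, map_neg, hC', hx', hform'] at h1 h2
    linear_combination h1 + h2
  have hw : ψ (φ (algebraMap (MvPolynomial σ k) _ (X w))) =
      algebraMap (MvPolynomial σ k) _ (X w) := by
    have h1 := congrArg ψ hφ.map_w
    have h2 := hψ.map_z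
    apply mul_left_cancel₀ (pow_ne_zero (e + 4) (hne (X_ne_zero x)))
    simp only [map_add, map_sub, map_mul, map_pow, map_neg, hC', hx', hform', hz] at h1 h2
    linear_combination h1 + h2
  have hy : ψ (φ (algebraMap (MvPolynomial σ k) _ (X y))) =
      algebraMap (MvPolynomial σ k) _ (X y) := by
    have h1 := (congrArg ψ hform).trans hform'
    apply mul_left_cancel₀ (pow_ne_zero (e + 3) (hne (X_ne_zero x)))
    simp only [map_twistedForm, map_add φ, map_mul φ, map_pow φ, map_add ψ, map_mul ψ, map_pow ψ,
      hx, hx', hz, hC, hC'] at h1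
    linear_combination h1
  refine IsLocalization.algHom_ext (.powers (twistedForm x y z e a')) (MvPolynomial.algHom_ext ?_)
  intro i
  change ψ (φ (algebraMap (MvPolynomial σ k) _ (X i))) = algebraMap _ _ (X i)
  by_cases hiz : i = z
  · rw [hiz, hz]
  by_cases hiw : i = w
  · rw [hiw, hw]
  by_cases hiy : i = y
  · rw [hiy, hy]
  · rw [hφ.map_of_ne i hiy hiz hiw, hψ.map_of_ne i hiy hiz hiw]

theorem exists_graded_equiv (hxy : x ≠ y) (hxz : x ≠ z) (hxw : x ≠ w) (hyz : y ≠ z) (hyw : y ≠ w)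
    (hzw : z ≠ w) (a a' : k) :
    ∃ φ : Localization.Away (twistedForm x y z e a') ≃ₐ[k]
      Localization.Away (twistedForm x y z e a),
    ∀ u, φ u ∈ fractionsOfDegree (twistedForm_isHomogeneous x y z e a) 0 ↔
      u ∈ fractionsOfDegree (twistedForm_isHomogeneous x y z e a') 0 := by
  obtain ⟨φ, hφ⟩ := exists_isTwist (e := e) hxy hxz hxw hyz hyw hzw
    (show a' + (a - a') = a by ring)
  obtain ⟨ψ, hψ⟩ := exists_isTwist (e := e) hxy hxz hxw hyz hyw hzw
    (show a + -(a - a') = a' by ring)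
  refine ⟨.ofAlgHom φ ψ (hψ.comp_eq_id hxy hxz hxw hyz (by simpa using hφ))
    (hφ.comp_eq_id hxy hxz hxw hyz hψ), fun u => ⟨fun hu => ?_, fun hu => ?_⟩⟩
  · have := map_mem_fractionsOfDegree _ (twistedForm_isHomogeneous x y z e a') ψ hψ.map_form
      (hψ.map_X_mem hxy hxz hxw hyz) hu
    have hu' : ψ (φ u) = u := DFunLike.congr_fun (hφ.comp_eq_id hxy hxz hxw hyz hψ) u
    rw [← hu']
    exact this
  · exact map_mem_fractionsOfDegree _ _ φ hφ.map_form (hφ.map_X_mem hxy hxz hxw hyz) hu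

end Twist

/-- **Proposition 3.2.**  Let `k` be a field, `d ≥ 4`, and let
`f = x^{d-1} y + z^d`, `g = x^{d-1} y + z^d + d x^{d-2} z^2` in `k[x, y, z]`
(with `x = x_0`, `y = x_1`, `z = x_2`).  Then for each `r ≥ 1` the open subvarieties
`ℙ^{r+2}_f` and `ℙ^{r+2}_g` of `ℙ^{r+2}_k` are isomorphic. -/
theorem stmt7 (k : Type) [Field k] (d : ℕ) (hd : 4 ≤ d) (r : ℕ) (hr : 1 ≤ r) :
    IsoOver
      (PnFStruct k (r + 2)
        (X 0 ^ (d - 1) * X 1 + X 2 ^ d))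
      (PnFStruct k (r + 2)
        (X 0 ^ (d - 1) * X 1 + X 2 ^ d
          + (d : MvPolynomial (Fin (r + 2 + 1)) k) * X 0 ^ (d - 2) * X 2 ^ 2)) := by
  obtain ⟨e, rfl⟩ := Nat.exists_eq_add_of_le' hd
  obtain ⟨s, rfl⟩ := Nat.exists_eq_add_of_le' hr
  have hne (i j : ℕ) (hi : i < 4) (hj : j < 4) (hij : i ≠ j) :
      Fin.ofNat (s + 1 + 2 + 1) i ≠ Fin.ofNat (s + 1 + 2 + 1) j := by
    simp only [ne_eq, Fin.ext_iff, Fin.val_ofNat]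
    rwa [Nat.mod_eq_of_lt (by omega), Nat.mod_eq_of_lt (by omega)]
  obtain ⟨φ, hφ⟩ := exists_graded_equiv (k := k) (x := (0 : Fin (s + 1 + 2 + 1))) (y := 1) (z := 2)
    (w := 3) (e := e) (hne 0 1 (by simp) (by simp) (by simp)) (hne 0 2 (by simp) (by simp) (by simp))
    (hne 0 3 (by simp) (by simp) (by simp)) (hne 1 2 (by simp) (by simp) (by simp))
    (hne 1 3 (by simp) (by simp) (by simp)) (hne 2 3 (by simp) (by simp) (by simp)) 0 1
  have hC : (C (4 : k) : MvPolynomial (Fin (s + 1 + 2 + 1)) k) = 4 := map_ofNat C 4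
  have hf : X 0 ^ (e + 4 - 1) * X 1 + X 2 ^ (e + 4) =
      twistedForm (0 : Fin (s + 1 + 2 + 1)) 1 2 e (0 : k) := by
    simp [twistedForm]
  have hg : X 0 ^ (e + 4 - 1) * X 1 + X 2 ^ (e + 4) + ((e + 4 : ℕ) :
      MvPolynomial (Fin (s + 1 + 2 + 1)) k) * X 0 ^ (e + 4 - 2) * X 2 ^ 2 =
      twistedForm (0 : Fin (s + 1 + 2 + 1)) 1 2 e (1 : k) := by
    simp [twistedForm, hC]
  rw [hg, hf]
  exact isoOver_of_graded (Nat.succ_pos _) _ _ φ hφ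

end
end

section
/- Let k be a field, let d ≥ 3 be an integer, and let f, g ∈ k[x_0, x_1, y, z] be the homogeneous polynomials of degree d defined by f = x_0^{d−1} y + z^d and g = x_0^{d−1} y + z^d + d x_0^{d−2} x_1^2. Then for each r ≥ 1, the open subvarieties P^{r+3}_f and P^{r+3}_g of P^{r+3}_k are isomorphic. -/
/-!
Common set-up: projective `n`-space over a field `k` as the scheme
`Proj k[x_0, …, x_n]`, complements of hypersurfaces as open subschemes,
hypersurfaces as reduced closed subschemes, and isomorphisms of varieties
over `k` as scheme isomorphisms commuting with the structure morphisms
to `Spec k`.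
-/

open AlgebraicGeometry CategoryTheory MvPolynomial

attribute [local instance] MvPolynomial.gradedAlgebra

noncomputable section

section LocalizationDegree

variable {k σ : Type} [Field k] {h : MvPolynomial σ k} {d : ℕ}

/-- An element of `k[x][1/h]` has degree `m`, where `h` has weight `d`, if it can be written as
`b / h ^ N` with `b` homogeneous of degree `m + N * d`. -/
def HasAwayDegree (h : MvPolynomial σ k) (d : ℕ) (m : ℤ) (t : Localization.Away h) : Prop :=
  ∃ (N e : ℕ) (b : MvPolynomial σ k), b.IsHomogeneous e ∧ (e : ℤ) = m + N * d ∧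
    t * algebraMap _ (Localization.Away h) h ^ N = algebraMap _ _ b

namespace HasAwayDegree

theorem of_isHomogeneous {m : ℕ} {b : MvPolynomial σ k} (hb : b.IsHomogeneous m) :
    HasAwayDegree h d m (algebraMap _ _ b) :=
  ⟨0, m, b, hb, by simp, by simp⟩

theorem var (j : σ) : HasAwayDegree h d 1 (algebraMap (MvPolynomial σ k) _ (X j)) := by
  simpa using of_isHomogeneous (h := h) (d := d) (isHomogeneous_X k j)

theorem algebraMap_base (c : k) : HasAwayDegree h d 0 (algebraMap k _ c) := by
  simpa [IsScalarTower.algebraMap_apply k (MvPolynomial σ k) (Localization.Away h)] using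
    of_isHomogeneous (h := h) (d := d) (isHomogeneous_C σ c)

theorem invSelf : HasAwayDegree h d (-d) (IsLocalization.Away.invSelf h) :=
  ⟨1, 0, 1, isHomogeneous_one σ k, by simp, by
    rw [pow_one, mul_comm, IsLocalization.Away.mul_invSelf, map_one]⟩

theorem mul {m₁ m₂ : ℤ} {t₁ t₂ : Localization.Away h} (h₁ : HasAwayDegree h d m₁ t₁)
    (h₂ : HasAwayDegree h d m₂ t₂) : HasAwayDegree h d (m₁ + m₂) (t₁ * t₂) := by
  obtain ⟨N₁, e₁, b₁, hb₁, he₁, ht₁⟩ := h₁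
  obtain ⟨N₂, e₂, b₂, hb₂, he₂, ht₂⟩ := h₂
  refine ⟨N₁ + N₂, e₁ + e₂, b₁ * b₂, hb₁.mul hb₂, by push_cast; rw [he₁, he₂]; ring, ?_⟩
  rw [map_mul, ← ht₁, ← ht₂]
  ring

theorem pow {m : ℤ} {t : Localization.Away h} (ht : HasAwayDegree h d m t) (n : ℕ) :
    HasAwayDegree h d (n * m) (t ^ n) := by
  obtain ⟨N, e, b, hb, he, ht⟩ := ht
  refine ⟨N * n, e * n, b ^ n, hb.pow n, by push_cast; rw [he]; ring, ?_⟩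
  rw [map_pow, ← ht]
  ring

theorem add {m : ℤ} {t₁ t₂ : Localization.Away h} (hh : h.IsHomogeneous d)
    (h₁ : HasAwayDegree h d m t₁) (h₂ : HasAwayDegree h d m t₂) :
    HasAwayDegree h d m (t₁ + t₂) := by
  obtain ⟨N₁, e₁, b₁, hb₁, he₁, ht₁⟩ := h₁
  obtain ⟨N₂, e₂, b₂, hb₂, he₂, ht₂⟩ := h₂
  have hdeg : e₂ + d * N₁ = e₁ + d * N₂ := by
    zify
    rw [he₁, he₂]
    ring
  refine ⟨N₁ + N₂, e₁ + d * N₂, b₁ * h ^ N₂ + b₂ * h ^ N₁,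
    (hb₁.mul (hh.pow N₂)).add (hdeg ▸ hb₂.mul (hh.pow N₁)), by push_cast; rw [he₁]; ring, ?_⟩
  rw [map_add, map_mul, map_mul, map_pow, map_pow, ← ht₁, ← ht₂]
  ring

theorem neg {m : ℤ} {t : Localization.Away h} (ht : HasAwayDegree h d m t) :
    HasAwayDegree h d m (-t) := by
  obtain ⟨N, e, b, hb, he, ht⟩ := ht
  exact ⟨N, e, -b, hb.neg, he, by rw [map_neg, ← ht]; ring⟩

theorem sub {m : ℤ} {t₁ t₂ : Localization.Away h} (hh : h.IsHomogeneous d)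
    (h₁ : HasAwayDegree h d m t₁) (h₂ : HasAwayDegree h d m t₂) :
    HasAwayDegree h d m (t₁ - t₂) :=
  sub_eq_add_neg t₁ t₂ ▸ h₁.add hh h₂.neg

theorem zero (m : ℕ) : HasAwayDegree h d m 0 :=
  map_zero (algebraMap (MvPolynomial σ k) (Localization.Away h)) ▸
    of_isHomogeneous (isHomogeneous_zero σ k m)

theorem sum {ι : Type} {m : ℕ} (hh : h.IsHomogeneous d) (s : Finset ι)
    (F : ι → Localization.Away h) (hF : ∀ j ∈ s, HasAwayDegree h d m (F j)) :
    HasAwayDegree h d m (∑ j ∈ s, F j) :=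
  Finset.sum_induction _ _ (fun _ _ ↦ add hh) (zero m) hF

theorem prod {ι : Type} (s : Finset ι) (e : ι → ℤ) (F : ι → Localization.Away h)
    (hF : ∀ j ∈ s, HasAwayDegree h d (e j) (F j)) :
    HasAwayDegree h d (∑ j ∈ s, e j) (∏ j ∈ s, F j) := by
  classical
  induction s using Finset.induction_on with
  | empty => simpa using of_isHomogeneous (h := h) (d := d) (isHomogeneous_one σ k)
  | insert j s hj ih =>
    rw [Finset.sum_insert hj, Finset.prod_insert hj]
    exact (hF j (Finset.mem_insert_self j s)).mul
      (ih fun i hi ↦ hF i (Finset.mem_insert_of_mem hi))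

theorem aeval {τ : Type} (hh : h.IsHomogeneous d) (F : τ → Localization.Away h)
    (hF : ∀ j, HasAwayDegree h d 1 (F j)) {p : MvPolynomial τ k} {m : ℕ}
    (hp : p.IsHomogeneous m) : HasAwayDegree h d m (MvPolynomial.aeval F p) := by
  rw [aeval_def, eval₂_eq]
  refine sum hh _ _ fun c hc ↦ ?_
  have hm : (m : ℤ) = 0 + ∑ j ∈ c.support, (c j : ℤ) * 1 := by
    have hdeg : ∑ j ∈ c.support, c j = m := by
      simpa [Finsupp.weight_apply, Finsupp.sum] using hp (mem_support_iff.1 hc)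
    rw [← hdeg]
    simp
  rw [hm]
  exact (algebraMap_base _).mul (prod _ _ _ fun j _ ↦ (hF j).pow (c j))

/-- Binomial expansion to second order, with control of the degree of the remainder. -/
theorem exists_add_pow (hh : h.IsHomogeneous d) {z e : Localization.Away h}
    (hz : HasAwayDegree h d 1 z) (he : HasAwayDegree h d 1 e) (n : ℕ) :
    ∃ S, HasAwayDegree h d n S ∧
      (z + e) ^ (n + 2) = z ^ (n + 2) + (n + 2) * z ^ (n + 1) * e + e ^ 2 * S := by
  induction n with
  | zero =>
    exact ⟨1, by simpa using of_isHomogeneous (h := h) (d := d) (isHomogeneous_one σ k),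
      by push_cast; ring⟩
  | succ n ih =>
    obtain ⟨S, hS, hpow⟩ := ih
    refine ⟨S * (z + e) + algebraMap k _ ((n + 2 : ℕ) : k) * z ^ (n + 1), ?_, ?_⟩
    · refine add hh (by simpa using hS.mul (hz.add hh he)) ?_
      convert (algebraMap_base _).mul (hz.pow (n + 1)) using 1
      simp
    · rw [pow_succ, hpow, map_natCast]
      push_cast
      ring

theorem iff_mem_range_val [DecidableEq σ] (hh : h ∈ homogeneousSubmodule σ k d)
    {t : Localization.Away h} :
    HasAwayDegree h d 0 t ↔
      ∃ a : HomogeneousLocalization.Away (homogeneousSubmodule σ k) h, a.val = t := by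
  have hunit : IsUnit (algebraMap (MvPolynomial σ k) (Localization.Away h) h) :=
    IsLocalization.Away.algebraMap_isUnit h
  have key (N : ℕ) (b) (hb : b ∈ homogeneousSubmodule σ k (N • d)) :
      (HomogeneousLocalization.Away.mk (homogeneousSubmodule σ k) hh N b hb).val *
        algebraMap _ (Localization.Away h) h ^ N = algebraMap _ _ b := by
    rw [HomogeneousLocalization.Away.val_mk, Localization.mk_eq_mk', ← map_pow]
    exact IsLocalization.mk'_spec (M := Submonoid.powers h) (Localization.Away h) b ⟨h ^ N, N, rfl⟩
  constructor
  · rintro ⟨N, e, b, hb, he, ht⟩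
    obtain rfl : e = N • d := by
      rw [smul_eq_mul]
      exact_mod_cast he.trans (zero_add _)
    exact ⟨.mk _ hh N b hb, (hunit.pow N).mul_left_injective ((key N b hb).trans ht.symm)⟩
  · rintro ⟨a, rfl⟩
    obtain ⟨N, b, hb, rfl⟩ := HomogeneousLocalization.Away.mk_surjective _ hh a
    exact ⟨N, N • d, b, hb, by simp, key N b hb⟩

theorem map {h' : MvPolynomial σ k} (hh' : h'.IsHomogeneous d)
    (Φ : Localization.Away h →ₐ[k] Localization.Away h')
    (hΦ : Φ (algebraMap _ _ h) = algebraMap _ _ h')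
    (hvar : ∀ j, HasAwayDegree h' d 1 (Φ (algebraMap (MvPolynomial σ k) _ (X j))))
    {m : ℤ} {t : Localization.Away h} (ht : HasAwayDegree h d m t) :
    HasAwayDegree h' d m (Φ t) := by
  obtain ⟨N, e, b, hb, he, ht⟩ := ht
  have haeval : Φ (algebraMap _ _ b) =
      MvPolynomial.aeval (fun j ↦ Φ (algebraMap (MvPolynomial σ k) _ (X j))) b := by
    have : Φ.comp (IsScalarTower.toAlgHom k (MvPolynomial σ k) _) =
        MvPolynomial.aeval (fun j ↦ Φ (algebraMap (MvPolynomial σ k) _ (X j))) := by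
      ext j
      simp
    exact DFunLike.congr_fun this b
  have hΦt : Φ t = Φ (algebraMap _ _ b) * IsLocalization.Away.invSelf h' ^ N := by
    rw [← ht, map_mul, map_pow, hΦ, mul_assoc, ← mul_pow, IsLocalization.Away.mul_invSelf,
      one_pow, mul_one]
  rw [hΦt, haeval]
  convert (aeval hh' _ hvar hb).mul (invSelf.pow N) using 1
  rw [he]
  ring

end HasAwayDegree

end LocalizationDegree

section Restriction

variable {A B R S : Type} [CommRing A] [CommRing B] [CommRing R] [CommRing S]

/-- Mutually inverse ring homomorphisms restrict to an isomorphism between subrings which they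
preserve. -/
theorem exists_ringEquiv_of_injective {i : A →+* R} {j : B →+* S}
    (hi : Function.Injective i) (hj : Function.Injective j) (φ : R →+* S) (ψ : S →+* R)
    (hφ : ∀ a, ∃ b, j b = φ (i a)) (hψ : ∀ b, ∃ a, i a = ψ (j b))
    (hψφ : ∀ x, ψ (φ x) = x) (hφψ : ∀ x, φ (ψ x) = x) :
    ∃ e : A ≃+* B, ∀ a, j (e a) = φ (i a) := by
  choose F hF using hφ
  choose G hG using hψ
  exact ⟨{ toFun := F
           invFun := G
           left_inv := fun a ↦ hi (by rw [hG, hF, hψφ])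
           right_inv := fun b ↦ hj (by rw [hF, hG, hφψ])
           map_mul' := fun a b ↦ hj (by simp only [hF, map_mul])
           map_add' := fun a b ↦ hj (by simp only [hF, map_add]) }, hF⟩

end Restriction

section ProjIso

variable {k : Type} [Field k] {n d : ℕ} {f g : MvPolynomial (Fin (n + 1)) k}

theorem basicOpenIsoSpec_hom_comp (hf : f ∈ grading k n d) (hd : 0 < d) :
    (Proj.basicOpenIsoSpec (grading k n) f hf hd).hom ≫
      Spec.map (CommRingCat.ofHom ((HomogeneousLocalization.fromZeroRingHom (grading k n) _).comp
        (algebraMap k (grading k n 0)))) = PnFStruct k n f := by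
  rw [CommRingCat.ofHom_comp, Spec.map_comp, ← Proj.awayι_toSpecZero (grading k n) f hf hd,
    ← Proj.basicOpenIsoSpec_inv_ι]
  simp only [Category.assoc, Iso.hom_inv_id_assoc]

theorem isoOver_of_ringEquiv (hf : f ∈ grading k n d) (hg : g ∈ grading k n d) (hd : 0 < d)
    (e : HomogeneousLocalization.Away (grading k n) f ≃+*
      HomogeneousLocalization.Away (grading k n) g)
    (he : ∀ c : k, e (HomogeneousLocalization.fromZeroRingHom (grading k n) _
        (algebraMap k (grading k n 0) c)) =
      HomogeneousLocalization.fromZeroRingHom (grading k n) _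
        (algebraMap k (grading k n 0) c)) :
    IsoOver (PnFStruct k n f) (PnFStruct k n g) := by
  refine ⟨Proj.basicOpenIsoSpec (grading k n) f hf hd ≪≫
    (Scheme.Spec.mapIso e.toCommRingCatIso.op).symm ≪≫
    (Proj.basicOpenIsoSpec (grading k n) g hg hd).symm, ?_⟩
  rw [← basicOpenIsoSpec_hom_comp hf hd, ← basicOpenIsoSpec_hom_comp hg hd]
  simp only [Iso.trans_hom, Iso.symm_hom, Category.assoc, Iso.inv_hom_id_assoc]
  congr 1
  rw [Iso.inv_comp_eq]
  refine Eq.trans ?_ (Spec.map_comp _ _)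
  congr 1
  exact CommRingCat.hom_ext (RingHom.ext fun c ↦ (he c).symm)

theorem isoOver_of_algHom (hf : f ∈ grading k n d) (hg : g ∈ grading k n d) (hd : 0 < d)
    (Φ : Localization.Away f →ₐ[k] Localization.Away g)
    (Ψ : Localization.Away g →ₐ[k] Localization.Away f)
    (hΦ : Φ (algebraMap _ _ f) = algebraMap _ _ g)
    (hΨ : Ψ (algebraMap _ _ g) = algebraMap _ _ f)
    (hΦX : ∀ j, HasAwayDegree g d 1 (Φ (algebraMap (MvPolynomial (Fin (n + 1)) k) _ (X j))))
    (hΨX : ∀ j, HasAwayDegree f d 1 (Ψ (algebraMap (MvPolynomial (Fin (n + 1)) k) _ (X j))))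
    (hΨΦ : ∀ x, Ψ (Φ x) = x) (hΦΨ : ∀ x, Φ (Ψ x) = x) :
    IsoOver (PnFStruct k n f) (PnFStruct k n g) := by
  obtain ⟨e, he⟩ := exists_ringEquiv_of_injective
    (i := algebraMap (HomogeneousLocalization.Away (grading k n) f) (Localization.Away f))
    (j := algebraMap (HomogeneousLocalization.Away (grading k n) g) (Localization.Away g))
    (HomogeneousLocalization.val_injective _) (HomogeneousLocalization.val_injective _)
    Φ.toRingHom Ψ.toRingHom
    (fun a ↦ (HasAwayDegree.iff_mem_range_val hg).1 <|
      ((HasAwayDegree.iff_mem_range_val hf).2 ⟨a, rfl⟩).map hg Φ hΦ hΦX)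
    (fun a ↦ (HasAwayDegree.iff_mem_range_val hf).1 <|
      ((HasAwayDegree.iff_mem_range_val hg).2 ⟨a, rfl⟩).map hf Ψ hΨ hΨX)
    hΨΦ hΦΨ
  refine isoOver_of_ringEquiv hf hg hd e fun c ↦ HomogeneousLocalization.val_injective _ ?_
  have hc (p : MvPolynomial (Fin (n + 1)) k) :
      (HomogeneousLocalization.fromZeroRingHom (grading k n) (Submonoid.powers p)
        (algebraMap k (grading k n 0) c)).val = algebraMap k (Localization.Away p) c :=
    Localization.mk_one_eq_algebraMap _
  refine (he _).trans ?_
  rw [HomogeneousLocalization.algebraMap_apply, hc, hc]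
  exact Φ.commutes c

end ProjIso

section Family

variable {k σ : Type} [Field k]

/-- The family of hypersurfaces `x ^ (n+2) y + z ^ (n+3) + s (n+3) x ^ (n+1) u ^ 2`, where `x`,
`u`, `y`, `z` are the variables with indices `i 0`, `i 1`, `i 2`, `i 3`. -/
def hypersurface (i : Fin 5 → σ) (n : ℕ) (s : k) : MvPolynomial σ k :=
  X (i 0) ^ (n + 2) * X (i 2) + X (i 3) ^ (n + 3) +
    C s * ((n + 3 : ℕ) : MvPolynomial σ k) * X (i 0) ^ (n + 1) * X (i 1) ^ 2

variable {i : Fin 5 → σ} {n : ℕ}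

theorem hypersurface_isHomogeneous (s : k) : (hypersurface i n s).IsHomogeneous (n + 3) := by
  refine .add (.add ?_ ?_) ?_
  · convert ((isHomogeneous_X k (i 0)).pow (n + 2)).mul (isHomogeneous_X k (i 2)) using 1
    omega
  · simpa using (isHomogeneous_X k (i 3)).pow (n + 3)
  · have hc : (C s * ((n + 3 : ℕ) : MvPolynomial σ k)) = C (s * ((n + 3 : ℕ) : k)) := by
      rw [C_mul, map_natCast]
    rw [hc]
    convert ((isHomogeneous_C σ (s * ((n + 3 : ℕ) : k))).mul
      ((isHomogeneous_X k (i 0)).pow (n + 1))).mul ((isHomogeneous_X k (i 1)).pow 2) using 1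
    omega

theorem hypersurface_ne_zero (hi : Function.Injective i) (s : k) : hypersurface i n s ≠ 0 := by
  classical
  intro h0
  have := congrArg (MvPolynomial.eval fun j ↦ if j = i 3 then (1 : k) else 0) h0
  simp [hypersurface, hi.eq_iff] at this

/-- The image of the variable `X j` in `k[x][1/h]`. -/
abbrev awayVar (h : MvPolynomial σ k) (j : σ) : Localization.Away h :=
  algebraMap (MvPolynomial σ k) _ (X j)

/-- The element `x ^ (n+1) u ^ 2 / h`, where `h` is the hypersurface with parameter `t`. -/
def shearCoeff (i : Fin 5 → σ) (n : ℕ) (t : k) : Localization.Away (hypersurface i n t) :=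
  awayVar _ (i 0) ^ (n + 1) * awayVar _ (i 1) ^ 2 *
    IsLocalization.Away.invSelf (hypersurface i n t)

/-- A degree-preserving homomorphism between the localized coordinate rings of the family
`hypersurface`, which acts on the variables with indices `i 3`, `i 4` by a matrix of determinant
one, and fixes all other variables except the one with index `i 2`. -/
structure IsShear (i : Fin 5 → σ) (n : ℕ) (s t : k)
    (Φ : Localization.Away (hypersurface i n s) →ₐ[k] Localization.Away (hypersurface i n t)) :
    Prop where
  map_hypersurface : Φ (algebraMap _ _ (hypersurface i n s)) = algebraMap _ _ (hypersurface i n t)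
  hasAwayDegree (j : σ) : HasAwayDegree (hypersurface i n t) (n + 3) 1 (Φ (awayVar _ j))
  map_of_ne (j : σ) : j ≠ i 2 → j ≠ i 3 → j ≠ i 4 → Φ (awayVar _ j) = awayVar _ j
  map_three : Φ (awayVar _ (i 3)) =
    (1 + algebraMap k _ (t - s) * shearCoeff i n t) * awayVar _ (i 3) -
      algebraMap k _ (t - s) * shearCoeff i n t ^ 2 * awayVar _ (i 4)
  map_four : Φ (awayVar _ (i 4)) = algebraMap k _ (t - s) * awayVar _ (i 3) +
    (1 - algebraMap k _ (t - s) * shearCoeff i n t) * awayVar _ (i 4)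

theorem shear_identity {R : Type} [CommRing R] (n : ℕ) {x u y z w v s t ε δ q e S : R}
    (hε : ε = t - s) (hq : q = x ^ (n + 1) * u ^ 2 * v)
    (he : e = ε * u ^ 2 * v * z - ε * x ^ (n + 1) * u ^ 4 * v ^ 2 * w)
    (hv : (x ^ (n + 2) * y + z ^ (n + 3) + t * δ * x ^ (n + 1) * u ^ 2) * v = 1)
    (hS : (z + x ^ (n + 1) * e) ^ (n + 3) = z ^ (n + 3) +
      δ * z ^ (n + 2) * (x ^ (n + 1) * e) + (x ^ (n + 1) * e) ^ 2 * S) :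
    x ^ (n + 2) * (y + ε * δ * x ^ (n + 1) * u ^ 2 * v * y + ε * t * δ ^ 2 * v * x ^ n * u ^ 4 +
        δ * ε * x ^ n * u ^ 4 * v ^ 2 * z ^ (n + 2) * w - x ^ n * e ^ 2 * S) +
      ((1 + ε * q) * z - ε * q ^ 2 * w) ^ (n + 3) + s * δ * x ^ (n + 1) * u ^ 2 =
    x ^ (n + 2) * y + z ^ (n + 3) + t * δ * x ^ (n + 1) * u ^ 2 := by
  have hZ : (1 + ε * q) * z - ε * q ^ 2 * w = z + x ^ (n + 1) * e := by
    rw [hq, he]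
    ring
  obtain rfl : s = t - ε := by rw [hε]; ring
  rw [hZ, hS]
  linear_combination ε * δ * x ^ (n + 1) * u ^ 2 * hv +
    δ * z ^ (n + 2) * x ^ (n + 1) * he

theorem exists_isShear (hi : Function.Injective i) (s t : k) :
    ∃ Φ : Localization.Away (hypersurface i n s) →ₐ[k] Localization.Away (hypersurface i n t),
      IsShear i n s t Φ := by
  classical
  set h := hypersurface i n t with hh
  have hhom : h.IsHomogeneous (n + 3) := hypersurface_isHomogeneous t
  set x := awayVar h (i 0)
  set u := awayVar h (i 1)
  set y := awayVar h (i 2)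
  set z := awayVar h (i 3)
  set w := awayVar h (i 4)
  set v : Localization.Away h := IsLocalization.Away.invSelf h
  set ε : Localization.Away h := algebraMap k _ (t - s) with hε
  set t' : Localization.Away h := algebraMap k _ t with ht'
  set s' : Localization.Away h := algebraMap k _ s with hs'
  set δ : Localization.Away h := algebraMap k _ ((n + 3 : ℕ) : k)
  have hδ' : δ = ((n + 3 : ℕ) : Localization.Away h) := map_natCast _ _
  have hεst : ε = t' - s' := by simp [hε, ht', hs']
  have hx : HasAwayDegree h (n + 3) 1 x := .var _
  have hu : HasAwayDegree h (n + 3) 1 u := .var _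
  have hy : HasAwayDegree h (n + 3) 1 y := .var _
  have hz : HasAwayDegree h (n + 3) 1 z := .var _
  have hw : HasAwayDegree h (n + 3) 1 w := .var _
  have hv : HasAwayDegree h (n + 3) (-(n + 3 : ℕ)) v := .invSelf
  have hεd : HasAwayDegree h (n + 3) 0 ε := .algebraMap_base _
  have htd : HasAwayDegree h (n + 3) 0 t' := .algebraMap_base _
  have hδd : HasAwayDegree h (n + 3) 0 δ := .algebraMap_base _
  have hone : HasAwayDegree h (n + 3) 0 1 := by
    simpa using HasAwayDegree.algebraMap_base (h := h) (d := n + 3) 1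
  have hht : algebraMap _ (Localization.Away h) h =
      x ^ (n + 2) * y + z ^ (n + 3) + t' * δ * x ^ (n + 1) * u ^ 2 := by
    rw [hδ', ht', IsScalarTower.algebraMap_apply k (MvPolynomial σ k) (Localization.Away h)]
    simp only [hh, hypersurface, map_add, map_mul, map_pow, map_natCast, x, y, z, u]
    rfl
  have hvh : (x ^ (n + 2) * y + z ^ (n + 3) + t' * δ * x ^ (n + 1) * u ^ 2) * v = 1 := by
    rw [← hht]
    exact IsLocalization.Away.mul_invSelf h
  obtain ⟨q, hq⟩ : ∃ q, q = x ^ (n + 1) * u ^ 2 * v := ⟨_, rfl⟩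
  obtain ⟨e, he⟩ : ∃ e, e = ε * u ^ 2 * v * z - ε * x ^ (n + 1) * u ^ 4 * v ^ 2 * w := ⟨_, rfl⟩
  have hqd : HasAwayDegree h (n + 3) 0 q := by
    rw [hq]
    convert ((hx.pow (n + 1)).mul (hu.pow 2)).mul hv using 1
    push_cast
    ring
  have hed : HasAwayDegree h (n + 3) (-n) e := by
    rw [he]
    refine .sub hhom ?_ ?_
    · convert ((hεd.mul (hu.pow 2)).mul hv).mul hz using 1
      push_cast
      ring
    · convert (((hεd.mul (hx.pow (n + 1))).mul (hu.pow 4)).mul (hv.pow 2)).mul hw using 1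
      push_cast
      ring
  have hxed : HasAwayDegree h (n + 3) 1 (x ^ (n + 1) * e) := by
    convert (hx.pow (n + 1)).mul hed using 1
    push_cast
    ring
  obtain ⟨S, hSd, hS⟩ := HasAwayDegree.exists_add_pow hhom hz hxed (n + 1)
  obtain ⟨Y, hY⟩ : ∃ Y, Y = y + ε * δ * x ^ (n + 1) * u ^ 2 * v * y +
      ε * t' * δ ^ 2 * v * x ^ n * u ^ 4 + δ * ε * x ^ n * u ^ 4 * v ^ 2 * z ^ (n + 2) * w -
      x ^ n * e ^ 2 * S := ⟨_, rfl⟩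
  have hYd : HasAwayDegree h (n + 3) 1 Y := by
    rw [hY]
    refine .sub hhom (.add hhom (.add hhom (.add hhom hy ?_) ?_) ?_) ?_
    · convert ((((hεd.mul hδd).mul (hx.pow (n + 1))).mul (hu.pow 2)).mul hv).mul hy using 1
      push_cast
      ring
    · convert ((((hεd.mul htd).mul (hδd.pow 2)).mul hv).mul (hx.pow n)).mul (hu.pow 4) using 1
      push_cast
      ring
    · convert (((((hδd.mul hεd).mul (hx.pow n)).mul (hu.pow 4)).mul (hv.pow 2)).mul
        (hz.pow (n + 2))).mul hw using 1
      push_cast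
      ring
    · convert ((hx.pow n).mul (hed.pow 2)).mul hSd using 1
      push_cast
      ring
  have hS' : (z + x ^ (n + 1) * e) ^ (n + 3) = z ^ (n + 3) +
      δ * z ^ (n + 2) * (x ^ (n + 1) * e) + (x ^ (n + 1) * e) ^ 2 * S := by
    rw [hδ']
    convert hS using 5
    push_cast
    ring
  have hmain := shear_identity n (w := w) hεst hq he hvh hS'
  rw [← hY] at hmain
  let F : σ → Localization.Away h := fun j ↦
    if j = i 2 then Y else if j = i 3 then (1 + ε * q) * z - ε * q ^ 2 * w else
      if j = i 4 then ε * z + (1 - ε * q) * w else awayVar h j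
  have hF0 : F (i 0) = x := by simp [F, hi.eq_iff, x]
  have hF1 : F (i 1) = u := by simp [F, hi.eq_iff, u]
  have hF2 : F (i 2) = Y := by simp [F]
  have hF3 : F (i 3) = (1 + ε * q) * z - ε * q ^ 2 * w := by simp [F, hi.eq_iff]
  have hF4 : F (i 4) = ε * z + (1 - ε * q) * w := by simp [F, hi.eq_iff]
  have hFd (j) : HasAwayDegree h (n + 3) 1 (F j) := by
    simp only [F]
    split_ifs
    · exact hYd
    · refine .sub hhom ?_ ?_
      · simpa using (hone.add hhom (hεd.mul hqd)).mul hz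
      · simpa using (hεd.mul (hqd.pow 2)).mul hw
    · refine .add hhom ?_ ?_
      · simpa using hεd.mul hz
      · simpa using (hone.sub hhom (hεd.mul hqd)).mul hw
    · exact .var j
  have hFh : MvPolynomial.aeval F (hypersurface i n s) = algebraMap _ _ h := by
    rw [hht, ← hmain, hδ']
    simp [hypersurface, hF0, hF1, hF2, hF3, hs']
  have hunit : ∀ b : Submonoid.powers (hypersurface i n s), IsUnit (MvPolynomial.aeval F b.1) := by
    rintro ⟨_, N, rfl⟩
    simp only [map_pow, hFh]
    exact (IsLocalization.Away.algebraMap_isUnit h).pow N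
  let Φ : Localization.Away (hypersurface i n s) →ₐ[k] Localization.Away h :=
    IsLocalization.liftAlgHom (f := MvPolynomial.aeval F) hunit
  have hΦ (b) : Φ (algebraMap _ _ b) = MvPolynomial.aeval F b := IsLocalization.lift_eq _ b
  have hΦX (j) : Φ (awayVar _ j) = F j := by rw [hΦ, aeval_X]
  refine ⟨Φ, by rw [hΦ, hFh], fun j ↦ hΦX j ▸ hFd j, fun j h2 h3 h4 ↦ ?_, ?_, ?_⟩
  · rw [hΦX]
    simp [F, h2, h3, h4, h]
  · rw [hΦX, hF3, hq]
    rfl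
  · rw [hΦX, hF4, hq]
    rfl

theorem IsShear.leftInverse (hi : Function.Injective i) {s t : k}
    {Φ : Localization.Away (hypersurface i n s) →ₐ[k] Localization.Away (hypersurface i n t)}
    {Ψ : Localization.Away (hypersurface i n t) →ₐ[k] Localization.Away (hypersurface i n s)}
    (hΦ : IsShear i n s t Φ) (hΨ : IsShear i n t s Ψ) : Function.LeftInverse Ψ Φ := by
  have hinv : Ψ (IsLocalization.Away.invSelf (hypersurface i n t)) =
      IsLocalization.Away.invSelf (hypersurface i n s) := by
    refine (IsLocalization.Away.algebraMap_isUnit (hypersurface i n s)).mul_left_cancel ?_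
    rw [IsLocalization.Away.mul_invSelf, ← hΨ.map_hypersurface, ← map_mul,
      IsLocalization.Away.mul_invSelf, map_one]
  have hx : Ψ (awayVar _ (i 0)) = awayVar _ (i 0) := hΨ.map_of_ne _
    (by simp [hi.eq_iff]) (by simp [hi.eq_iff]) (by simp [hi.eq_iff])
  have hu : Ψ (awayVar _ (i 1)) = awayVar _ (i 1) := hΨ.map_of_ne _
    (by simp [hi.eq_iff]) (by simp [hi.eq_iff]) (by simp [hi.eq_iff])
  have hx' : Ψ (Φ (awayVar _ (i 0))) = awayVar _ (i 0) := by
    rw [hΦ.map_of_ne _ (by simp [hi.eq_iff]) (by simp [hi.eq_iff]) (by simp [hi.eq_iff]), hx]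
  have hu' : Ψ (Φ (awayVar _ (i 1))) = awayVar _ (i 1) := by
    rw [hΦ.map_of_ne _ (by simp [hi.eq_iff]) (by simp [hi.eq_iff]) (by simp [hi.eq_iff]), hu]
  have hq : Ψ (shearCoeff i n t) = shearCoeff i n s := by
    simp only [shearCoeff, map_mul, map_pow, hx, hu, hinv]
  have hneg : algebraMap k (Localization.Away (hypersurface i n s)) (t - s) =
      -algebraMap k _ (s - t) := by
    rw [← map_neg, neg_sub]
  have hz : Ψ (Φ (awayVar _ (i 3))) = awayVar _ (i 3) := by
    simp only [hΦ.map_three, map_sub Ψ, map_add Ψ, map_mul, map_pow, map_one, AlgHom.commutes, hq,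
      hΨ.map_three, hΨ.map_four, hneg]
    ring
  have hw : Ψ (Φ (awayVar _ (i 4))) = awayVar _ (i 4) := by
    simp only [hΦ.map_four, map_sub Ψ, map_add Ψ, map_mul, map_one, AlgHom.commutes, hq,
      hΨ.map_three, hΨ.map_four, hneg]
    ring
  have hh : Ψ (Φ (algebraMap _ _ (hypersurface i n s))) = algebraMap _ _ (hypersurface i n s) := by
    rw [hΦ.map_hypersurface, hΨ.map_hypersurface]
  have hinj := IsLocalization.injective (Localization.Away (hypersurface i n s))
    (powers_le_nonZeroDivisors_of_noZeroDivisors (hypersurface_ne_zero (n := n) hi s))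
  have : IsDomain (Localization.Away (hypersurface i n s)) :=
    IsLocalization.isDomain_localization
      (powers_le_nonZeroDivisors_of_noZeroDivisors (hypersurface_ne_zero hi s))
  have hx0 : awayVar (hypersurface i n s) (i 0) ^ (n + 2) ≠ 0 :=
    pow_ne_zero _ ((map_ne_zero_iff _ hinj).2 (X_ne_zero _))
  have hy : Ψ (Φ (awayVar _ (i 2))) = awayVar _ (i 2) := by
    refine mul_left_cancel₀ hx0 ?_
    have hC : algebraMap (MvPolynomial σ k) (Localization.Away (hypersurface i n s)) (C s) =
        algebraMap k _ s := rfl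
    have heq : algebraMap _ (Localization.Away (hypersurface i n s)) (hypersurface i n s) =
        awayVar _ (i 0) ^ (n + 2) * awayVar _ (i 2) + awayVar _ (i 3) ^ (n + 3) +
          algebraMap k _ s * ((n + 3 : ℕ) : Localization.Away (hypersurface i n s)) *
            awayVar _ (i 0) ^ (n + 1) * awayVar _ (i 1) ^ 2 := by
      conv_lhs => enter [2]; rw [hypersurface]
      simp only [map_add, map_mul, map_pow, map_natCast, hC]
    rw [heq] at hh
    simp only [map_add Ψ, map_add Φ, map_mul, map_pow, map_natCast, AlgHom.commutes, hx', hu',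
      hz] at hh
    linear_combination hh
  have hid : Ψ.comp Φ = AlgHom.id k _ := by
    refine IsLocalization.algHom_ext (Submonoid.powers (hypersurface i n s)) ?_
    refine MvPolynomial.algHom_ext fun j ↦ ?_
    change Ψ (Φ (awayVar _ j)) = awayVar _ j
    by_cases h2 : j = i 2
    · rw [h2, hy]
    by_cases h3 : j = i 3
    · rw [h3, hz]
    by_cases h4 : j = i 4
    · rw [h4, hw]
    rw [hΦ.map_of_ne j h2 h3 h4, hΨ.map_of_ne j h2 h3 h4]
  exact DFunLike.congr_fun hid

theorem isoOver_hypersurface {m : ℕ} {i : Fin 5 → Fin (m + 1)} (hi : Function.Injective i)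
    (n : ℕ) (s t : k) :
    IsoOver (PnFStruct k m (hypersurface i n s)) (PnFStruct k m (hypersurface i n t)) := by
  obtain ⟨Φ, hΦ⟩ := exists_isShear (n := n) hi s t
  obtain ⟨Ψ, hΨ⟩ := exists_isShear (n := n) hi t s
  exact isoOver_of_algHom (hypersurface_isHomogeneous s) (hypersurface_isHomogeneous t)
    (Nat.succ_pos _) Φ Ψ hΦ.map_hypersurface hΨ.map_hypersurface hΦ.hasAwayDegree
    hΨ.hasAwayDegree (hΦ.leftInverse hi hΨ) (hΨ.leftInverse hi hΦ)

end Family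

/-- **Proposition 3.4.**  Let `k` be a field, `d ≥ 3`, and let
`f = x_0^{d-1} y + z^d`, `g = x_0^{d-1} y + z^d + d x_0^{d-2} x_1^2` in
`k[x_0, x_1, y, z]` (with `x_0 = x_0`, `x_1 = x_1`, `y = x_2`, `z = x_3`).  Then for
each `r ≥ 1` the open subvarieties `ℙ^{r+3}_f` and `ℙ^{r+3}_g` of `ℙ^{r+3}_k` are
isomorphic. -/
theorem stmt8 (k : Type) [Field k] (d : ℕ) (hd : 3 ≤ d) (r : ℕ) (hr : 1 ≤ r) :
    IsoOver
      (PnFStruct k (r + 3)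
        (X 0 ^ (d - 1) * X 2 + X 3 ^ d))
      (PnFStruct k (r + 3)
        (X 0 ^ (d - 1) * X 2 + X 3 ^ d
          + (d : MvPolynomial (Fin (r + 3 + 1)) k) * X 0 ^ (d - 2) * X 1 ^ 2)) := by
  obtain ⟨n, rfl⟩ : ∃ n, d = n + 3 := ⟨d - 3, by omega⟩
  have h5 : 5 ≤ r + 3 + 1 := by omega
  have hcast (j : ℕ) (hj : j < 5) :
      Fin.castLE h5 (Fin.ofNat 5 j) = Fin.ofNat (r + 3 + 1) j := by
    ext
    simp [Nat.mod_eq_of_lt hj, Nat.mod_eq_of_lt (hj.trans_le h5)]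
  have h0 : Fin.castLE h5 0 = 0 := hcast 0 (by omega)
  have h1 : Fin.castLE h5 1 = 1 := hcast 1 (by omega)
  have h2 : Fin.castLE h5 2 = 2 := hcast 2 (by omega)
  have h3 : Fin.castLE h5 3 = 3 := hcast 3 (by omega)
  have hf : hypersurface (Fin.castLE h5) n (0 : k) =
      X 0 ^ (n + 3 - 1) * X 2 + X 3 ^ (n + 3) := by
    rw [hypersurface, h0, h1, h2, h3, C_0, zero_mul, zero_mul, zero_mul, add_zero,
      Nat.add_sub_assoc (by omega)]
  have hg : hypersurface (Fin.castLE h5) n (1 : k) =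
      X 0 ^ (n + 3 - 1) * X 2 + X 3 ^ (n + 3) +
        ((n + 3 : ℕ) : MvPolynomial (Fin (r + 3 + 1)) k) * X 0 ^ (n + 3 - 2) * X 1 ^ 2 := by
    rw [hypersurface, h0, h1, h2, h3, C_1, one_mul, Nat.add_sub_assoc (by omega),
      Nat.add_sub_assoc (by omega)]
  rw [← hg, ← hf]
  exact isoOver_hypersurface (Fin.castLE_injective h5) n 0 1

end
end
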